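/- Let M ≥ 1 be an integer, let α_k, β_k > 0 for k = 1,…,M, let m be a nonnegative integer, and suppose ∑_{k=1}^M α_k > m + (1/2)(M + 1/2) and λ ≥ π·∑_{k=1}^M β_k. Then ∫_0^∞ x^{2m}·J_{2m+3}(λx)·g_M(x) dx = ((2m+1)! / (2·∏_{k=1}^M Γ(α_k)^2)) · (2/λ)^{2m+1} · [1 − (8(m+1)/λ^2)·∑_{k=1}^M β_k^2·ψ^{(1)}(α_k)], where ψ^{(1)} denotes the trigamma function (the derivative of the digamma function ψ = Γ'/Γ). -/

import Mathlib

open MeasureTheory Real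

/-- Bessel function of the first kind of nonnegative integer order `n`. -/
noncomputable def besselJ (n : ℕ) (x : ℝ) : ℝ :=
  ∑' k : ℕ, (-1 : ℝ) ^ k / (Nat.factorial k * Nat.factorial (n + k)) * (x / 2) ^ (n + 2 * k)

/-- The product of reciprocal Gamma functions `∏_{k<M} 1/(Γ(α k + β k x) Γ(α k - β k x))`. -/
noncomputable def gammaProd (M : ℕ) (α β : ℕ → ℝ) (x : ℝ) : ℝ :=
  ∏ k ∈ Finset.range M, (Real.Gamma (α k + β k * x) * Real.Gamma (α k - β k * x))⁻¹

/-- The digamma function `ψ = Γ'/Γ`. -/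
noncomputable def digamma (x : ℝ) : ℝ := deriv Real.Gamma x / Real.Gamma x

/-- The `n`-th polygamma function, the `n`-th derivative of the digamma function. -/
noncomputable def polygamma (n : ℕ) (x : ℝ) : ℝ := iteratedDeriv n digamma x

open Filter Topology
open scoped FourierTransform SchwartzMap ContDiff

/-- The entire function `∑ (-z)^k / (k! (n+k)!)`, for which `J_n(x) = (x/2)^n E_n(x²/4)`. -/
noncomputable def besselE (n : ℕ) (z : ℝ) : ℝ :=
  ∑' k : ℕ, (-1 : ℝ) ^ k / (Nat.factorial k * Nat.factorial (n + k)) * z ^ k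

lemma summable_besselE (n : ℕ) (z : ℝ) :
    Summable fun k : ℕ => (-1 : ℝ) ^ k / (Nat.factorial k * Nat.factorial (n + k)) * z ^ k := by
  refine Summable.of_norm_bounded (Real.summable_pow_div_factorial |z|) fun k => ?_
  rw [norm_mul, norm_div, norm_pow, norm_pow, norm_neg, norm_one, one_pow, Real.norm_eq_abs z,
    Real.norm_of_nonneg (by positivity), one_div_mul_eq_div]
  gcongr
  have : (1 : ℝ) ≤ Nat.factorial (n + k) := by exact_mod_cast Nat.factorial_pos _
  nlinarith [show (0 : ℝ) < Nat.factorial k by positivity]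

lemma hasDerivAt_besselE (n : ℕ) (z : ℝ) : HasDerivAt (besselE n) (-besselE (n + 1) z) z := by
  have key := hasDerivAt_tsum_of_isPreconnected (𝕜 := ℝ) (F := ℝ)
    (g := fun (k : ℕ) (y : ℝ) => (-1 : ℝ) ^ k / (Nat.factorial k * Nat.factorial (n + k)) * y ^ k)
    (g' := fun (k : ℕ) (y : ℝ) =>
      (-1 : ℝ) ^ k / (Nat.factorial k * Nat.factorial (n + k)) * (k * y ^ (k - 1)))
    (u := fun k : ℕ => k * (|z| + 1) ^ (k - 1) / Nat.factorial k)
    (t := Metric.ball 0 (|z| + 1)) (y₀ := z) (y := z) ?_ Metric.isOpen_ball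
    (convex_ball _ _).isPreconnected ?_ ?_ (by simp) (summable_besselE n z) (by simp)
  · refine key.congr_deriv ?_
    rw [Summable.tsum_eq_zero_add]
    · simp only [besselE, Nat.cast_zero, zero_mul, mul_zero, zero_add, ← tsum_neg]
      refine tsum_congr fun k => ?_
      rw [Nat.add_sub_cancel, Nat.factorial_succ, show n + (k + 1) = n + 1 + k by ring]
      have : ((k : ℝ) + 1) ≠ 0 := by positivity
      push_cast
      field_simp
      ring
    · rw [← summable_nat_add_iff 1]
      refine ((summable_besselE (n + 1) z).neg).congr fun k => ?_
      rw [Nat.add_sub_cancel, Nat.factorial_succ, show n + (k + 1) = n + 1 + k by ring]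
      have : ((k : ℝ) + 1) ≠ 0 := by positivity
      push_cast
      field_simp
      ring
  · rw [← summable_nat_add_iff 1]
    refine (Real.summable_pow_div_factorial (|z| + 1)).congr fun k => ?_
    rw [Nat.add_sub_cancel, Nat.factorial_succ]
    have : ((k : ℝ) + 1) ≠ 0 := by positivity
    push_cast
    field_simp
  · intro k y _
    exact (hasDerivAt_pow k y).const_mul _
  · intro k y hy
    have hy' : |y| ≤ |z| + 1 := by simpa using (mem_ball_zero_iff.1 hy).le
    rw [norm_mul, norm_div, norm_pow, norm_neg, norm_one, one_pow, norm_mul (k : ℝ), norm_pow,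
      Real.norm_eq_abs y, Real.norm_of_nonneg (by positivity), one_div_mul_eq_div]
    simp only [RCLike.norm_natCast]
    gcongr
    have : (1 : ℝ) ≤ Nat.factorial (n + k) := by exact_mod_cast Nat.factorial_pos _
    nlinarith [show (0 : ℝ) < Nat.factorial k by positivity]

lemma besselE_recurrence (n : ℕ) (z : ℝ) :
    besselE n z = (n + 1) * besselE (n + 1) z - z * besselE (n + 2) z := by
  have h1 := summable_besselE (n + 1) z
  have h2 := summable_besselE (n + 2) z
  have h0 := summable_besselE n z
  unfold besselE
  rw [Summable.tsum_eq_zero_add h0, Summable.tsum_eq_zero_add h1, mul_add, ← tsum_mul_left,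
    ← tsum_mul_left, add_sub_assoc,
    ← Summable.tsum_sub (((summable_nat_add_iff 1).2 h1).mul_left _) (h2.mul_left _)]
  congr 1
  · simp [Nat.factorial_succ]
    field_simp
  · refine tsum_congr fun k => ?_
    rw [show n + 1 + (k + 1) = n + k + 1 + 1 by ring, show n + (k + 1) = n + k + 1 by ring,
      show n + 2 + k = n + k + 1 + 1 by ring, Nat.factorial_succ (n + k + 1),
      Nat.factorial_succ k]
    have : ((k : ℝ) + 1) ≠ 0 := by positivity
    have : ((n + k + 1 : ℝ) + 1) ≠ 0 := by positivity
    push_cast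
    field_simp
    ring

lemma besselJ_eq (n : ℕ) (x : ℝ) : besselJ n x = (x / 2) ^ n * besselE n (x ^ 2 / 4) := by
  rw [besselJ, besselE, ← tsum_mul_left]
  refine tsum_congr fun k => ?_
  rw [pow_add, pow_mul, show (x / 2) ^ 2 = x ^ 2 / 4 by ring]
  ring

lemma besselJ_zero_zero : besselJ 0 0 = 1 := by
  rw [besselJ_eq, besselE, tsum_eq_single 0]
  · simp
  · intro k hk
    simp [hk]

lemma besselJ_succ_zero (n : ℕ) : besselJ (n + 1) 0 = 0 := by
  simp [besselJ_eq]

/-- `2 (n+1) J_{n+1}(x) = x (J_n(x) + J_{n+2}(x))`. -/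
lemma besselJ_recurrence (n : ℕ) (x : ℝ) :
    2 * (n + 1) * besselJ (n + 1) x = x * (besselJ n x + besselJ (n + 2) x) := by
  rw [besselJ_eq, besselJ_eq, besselJ_eq, besselE_recurrence n]
  ring

lemma hasDerivAt_besselJ_zero (x : ℝ) : HasDerivAt (besselJ 0) (-besselJ 1 x) x := by
  have h := (hasDerivAt_besselE 0 (x ^ 2 / 4)).comp x ((hasDerivAt_pow 2 x).div_const 4)
  have he : besselJ 0 = besselE 0 ∘ fun x => x ^ 2 / 4 := by
    ext y
    simp [besselJ_eq]
  rw [he, besselJ_eq]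
  refine h.congr_deriv ?_
  push_cast
  ring

lemma hasDerivAt_besselJ_succ (n : ℕ) (x : ℝ) :
    HasDerivAt (besselJ (n + 1)) ((besselJ n x - besselJ (n + 2) x) / 2) x := by
  have h := (((hasDerivAt_id x).div_const 2).pow (n + 1)).mul
    ((hasDerivAt_besselE (n + 1) (x ^ 2 / 4)).comp x ((hasDerivAt_pow 2 x).div_const 4))
  have he : besselJ (n + 1) = ((fun x => x / 2) ^ (n + 1) : ℝ → ℝ) *
      (besselE (n + 1) ∘ fun x => x ^ 2 / 4) := by
    ext y
    simp [besselJ_eq]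
  rw [he]
  refine h.congr_deriv ?_
  rw [besselJ_eq, besselJ_eq, besselE_recurrence n]
  simp only [Function.comp, Pi.pow_apply, id]
  push_cast
  ring

lemma continuous_besselJ (n : ℕ) : Continuous (besselJ n) := by
  rcases n with _ | n
  · exact continuous_iff_continuousAt.2 fun x => (hasDerivAt_besselJ_zero x).continuousAt
  · exact continuous_iff_continuousAt.2 fun x => (hasDerivAt_besselJ_succ n x).continuousAt

/-- `J_n' = (n/x) J_n - J_{n+1}`. -/
lemma hasDerivAt_besselJ (n : ℕ) {x : ℝ} (hx : x ≠ 0) :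
    HasDerivAt (besselJ n) (n / x * besselJ n x - besselJ (n + 1) x) x := by
  rcases n with _ | n
  · simpa using hasDerivAt_besselJ_zero x
  · refine (hasDerivAt_besselJ_succ n x).congr_deriv ?_
    have := besselJ_recurrence n x
    push_cast
    field_simp
    linarith

/-- `J_{n+1}' = J_n - ((n+1)/x) J_{n+1}`. -/
lemma hasDerivAt_besselJ_succ' (n : ℕ) {x : ℝ} (hx : x ≠ 0) :
    HasDerivAt (besselJ (n + 1)) (besselJ n x - (n + 1) / x * besselJ (n + 1) x) x := by
  refine (hasDerivAt_besselJ_succ n x).congr_deriv ?_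
  have := besselJ_recurrence n x
  field_simp
  linarith

/-- The energy `x (J_n² + J_{n+1}²) - (2n+1) J_n J_{n+1}`. -/
noncomputable def besselEnergy (n : ℕ) (x : ℝ) : ℝ :=
  x * (besselJ n x ^ 2 + besselJ (n + 1) x ^ 2) - (2 * n + 1) * (besselJ n x * besselJ (n + 1) x)

lemma hasDerivAt_besselEnergy (n : ℕ) {x : ℝ} (hx : x ≠ 0) :
    HasDerivAt (besselEnergy n) ((2 * n + 1) * (besselJ n x * besselJ (n + 1) x) / x) x := by
  have h0 := hasDerivAt_besselJ n hx
  have h1 := hasDerivAt_besselJ_succ' n hx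
  have h := ((hasDerivAt_id x).mul ((h0.pow 2).add (h1.pow 2))).sub
    ((h0.mul h1).const_mul (2 * n + 1 : ℝ))
  refine (h.congr_deriv ?_)
  simp only [Pi.add_apply, Pi.pow_apply, id]
  field_simp
  ring

lemma besselJ_sq_le_energy (n : ℕ) {x : ℝ} (hx : 2 * n + 1 ≤ x) :
    x * (besselJ n x ^ 2 + besselJ (n + 1) x ^ 2) ≤ 2 * besselEnergy n x := by
  unfold besselEnergy
  have hn : (0 : ℝ) ≤ n := n.cast_nonneg
  nlinarith [mul_nonneg (sub_nonneg.2 hx) (sq_nonneg (besselJ n x)),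
    mul_nonneg (sub_nonneg.2 hx) (sq_nonneg (besselJ (n + 1) x)),
    mul_nonneg (by linarith : (0 : ℝ) ≤ 2 * n + 1) (sq_nonneg (besselJ n x - besselJ (n + 1) x))]

lemma besselEnergy_bounded (n : ℕ) : ∃ C, ∀ x : ℝ, 2 * n + 1 ≤ x → besselEnergy n x ≤ C := by
  set c : ℝ := 2 * n + 1
  have hc : 1 ≤ c := by simp [c]
  have hd : ∀ x : ℝ, x ≠ 0 → HasDerivAt (fun x => besselEnergy n x * exp (c / x))
      (c * (besselJ n x * besselJ (n + 1) x) / x * exp (c / x) +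
        besselEnergy n x * (exp (c / x) * (-c / x ^ 2))) x := by
    intro x hx
    refine (hasDerivAt_besselEnergy n hx).mul ?_
    have h := ((hasDerivAt_inv hx).const_mul c).exp
    simp only [← div_eq_mul_inv] at h
    refine h.congr_deriv ?_
    ring
  have hanti : AntitoneOn (fun x => besselEnergy n x * exp (c / x)) (Set.Ici c) := by
    refine antitoneOn_of_deriv_nonpos (convex_Ici c) ?_ ?_ ?_
    · exact fun x hx => (hd x (by simp at hx; linarith)).continuousAt.continuousWithinAt
    · exact fun x hx =>
        (hd x (by simp at hx; linarith)).differentiableAt.differentiableWithinAt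
    · intro x hx
      have hx : c < x := by simpa using hx
      have hx0 : 0 < x := by linarith
      rw [(hd x hx0.ne').deriv]
      have hE := besselJ_sq_le_energy n hx.le
      have : c * (besselJ n x * besselJ (n + 1) x) / x * exp (c / x) +
        besselEnergy n x * (exp (c / x) * (-c / x ^ 2)) =
        -(c * exp (c / x) / x ^ 2) *
          (besselEnergy n x - x * (besselJ n x * besselJ (n + 1) x)) := by
        field_simp
        ring
      rw [this]
      have h2 : 0 ≤ besselEnergy n x - x * (besselJ n x * besselJ (n + 1) x) := by
        nlinarith [mul_nonneg hx0.le (sq_nonneg (besselJ n x - besselJ (n + 1) x))]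
      have h3 : 0 ≤ c * exp (c / x) / x ^ 2 := by positivity
      nlinarith [mul_nonneg h3 h2]
  refine ⟨besselEnergy n c * exp (c / c), fun x hx => ?_⟩
  have h := hanti (Set.self_mem_Ici) (Set.mem_Ici.2 hx) hx
  refine le_trans ?_ h
  have hx0 : 0 < x := by linarith
  have hE : 0 ≤ besselEnergy n x := by
    have := besselJ_sq_le_energy n hx
    nlinarith [mul_nonneg hx0.le (add_nonneg (sq_nonneg (besselJ n x))
      (sq_nonneg (besselJ (n + 1) x)))]
  exact le_mul_of_one_le_right hE (Real.one_le_exp (by positivity))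

lemma besselJ_decay (n : ℕ) :
    ∃ C, 0 ≤ C ∧ ∀ x : ℝ, 0 ≤ x → |besselJ n x| ≤ C * (1 + x) ^ (-(1 / 2) : ℝ) := by
  obtain ⟨C, hC⟩ := besselEnergy_bounded n
  have hn : (0 : ℝ) ≤ n := n.cast_nonneg
  obtain ⟨B, hB⟩ := (isCompact_Icc (a := (0 : ℝ)) (b := 2 * n + 1)).exists_bound_of_continuousOn
    (f := fun x => (1 + x) * besselJ n x ^ 2)
    (((continuous_const.add continuous_id).mul ((continuous_besselJ n).pow 2)).continuousOn)
  have hmain : ∀ x : ℝ, 0 ≤ x → (1 + x) * besselJ n x ^ 2 ≤ max B (4 * C) := by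
    intro x hx
    rcases le_total x (2 * n + 1) with h | h
    · exact le_trans (le_trans (le_abs_self _) (hB x ⟨hx, h⟩)) (le_max_left _ _)
    · refine le_trans ?_ (le_max_right _ _)
      have h1 := besselJ_sq_le_energy n h
      have h2 := hC x h
      have h3 : 1 + x ≤ 2 * x := by linarith
      nlinarith [mul_nonneg hx (sq_nonneg (besselJ (n + 1) x)),
        mul_le_mul_of_nonneg_right h3 (sq_nonneg (besselJ n x))]
  refine ⟨√(max B (4 * C)), Real.sqrt_nonneg _, fun x hx => ?_⟩
  have hx1 : 0 < 1 + x := by linarith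
  rw [Real.rpow_neg hx1.le, ← Real.sqrt_eq_rpow, ← div_eq_mul_inv,
    le_div_iff₀ (Real.sqrt_pos.2 hx1)]
  refine Real.le_sqrt_of_sq_le ?_
  rw [mul_pow, Real.sq_sqrt hx1.le, sq_abs, mul_comm]
  exact hmain x hx

lemma besselJ_bounded (n : ℕ) : ∃ C, 0 ≤ C ∧ ∀ x : ℝ, 0 ≤ x → |besselJ n x| ≤ C := by
  obtain ⟨C, hC0, hC⟩ := besselJ_decay n
  refine ⟨C, hC0, fun x hx => (hC x hx).trans (mul_le_of_le_one_right hC0 ?_)⟩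
  exact Real.rpow_le_one_of_one_le_of_nonpos (by linarith) (by norm_num)

/-- `H` is the Fourier transform of a smooth function supported in `[-r, r]`. -/
def IsBandLimited (r : ℝ) (H : ℝ → ℂ) : Prop :=
  ∃ σ : ℝ → ℂ, ContDiff ℝ ∞ σ ∧ (∀ s, r < |s| → σ s = 0) ∧ H = 𝓕 σ

lemma hasCompactSupport_of_eq_zero {E : Type*} [Zero E] {σ : ℝ → E} {r : ℝ}
    (h : ∀ s, r < |s| → σ s = 0) :
    HasCompactSupport σ :=
  HasCompactSupport.intro (isCompact_closedBall (0 : ℝ) r) fun s hs => h s (by simpa using hs)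

lemma integrable_of_smooth_of_eq_zero {σ : ℝ → ℂ} {r : ℝ} (hσ : Continuous σ)
    (h : ∀ s, r < |s| → σ s = 0) : Integrable σ :=
  hσ.integrable_of_hasCompactSupport (hasCompactSupport_of_eq_zero h)

lemma deriv_eq_zero_of_eq_zero {σ : ℝ → ℂ} {r : ℝ} (h : ∀ s, r < |s| → σ s = 0) :
    ∀ s, r < |s| → deriv σ s = 0 := by
  intro s hs
  have : σ =ᶠ[𝓝 s] fun _ => 0 := by
    filter_upwards [(isOpen_lt continuous_const continuous_abs).mem_nhds hs] with t ht
    exact h t ht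
  rw [this.deriv_eq, deriv_const]

lemma fourier_add_fun {f g : ℝ → ℂ} (hf : Integrable f) (hg : Integrable g) :
    𝓕 (fun s => f s + g s) = fun y => 𝓕 f y + 𝓕 g y := by
  ext y
  exact (congrFun (VectorFourier.fourierIntegral_add continuous_fourierChar
    (L := innerₗ ℝ) continuous_inner hf hg) y)

lemma fourier_const_mul_fun (c : ℂ) (f : ℝ → ℂ) :
    𝓕 (fun s => c * f s) = fun y => c * 𝓕 f y := by
  ext y
  simp only [Real.fourier_real_eq, Circle.smul_def, smul_eq_mul, ← integral_const_mul]
  exact integral_congr_ae (Eventually.of_forall fun s => by simp only []; ring)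

lemma fourier_comp_neg (f : ℝ → ℂ) : 𝓕 (fun s => f (-s)) = fun y => 𝓕 f (-y) := by
  ext y
  rw [Real.fourier_real_eq, Real.fourier_real_eq, ← integral_neg_eq_self]
  simp

namespace IsBandLimited

variable {r : ℝ} {H K : ℝ → ℂ}

lemma exists_schwartz (hH : IsBandLimited r H) : ∃ f : 𝓢(ℝ, ℂ), (f : ℝ → ℂ) = H := by
  obtain ⟨σ, hσ, h0, rfl⟩ := hH
  refine ⟨𝓕 ((hasCompactSupport_of_eq_zero h0).toSchwartzMap hσ), ?_⟩
  rw [SchwartzMap.fourier_coe]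
  rfl

lemma deriv (hH : IsBandLimited r H) : IsBandLimited r (deriv H) := by
  obtain ⟨σ, hσ, h0, rfl⟩ := hH
  refine ⟨fun s => (-2 * π * Complex.I * s) • σ s, ?_, ?_, ?_⟩
  · have : ContDiff ℝ ∞ fun s : ℝ => (s : ℂ) := Complex.ofRealCLM.contDiff
    fun_prop
  · intro s hs
    simp [h0 s hs]
  · refine Real.deriv_fourier (integrable_of_smooth_of_eq_zero hσ.continuous h0)
      (integrable_of_smooth_of_eq_zero (r := r) ?_ ?_)
    · exact continuous_id.smul hσ.continuous
    · intro s hs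
      simp [h0 s hs]

lemma add (hH : IsBandLimited r H) (hK : IsBandLimited r K) :
    IsBandLimited r (fun y => H y + K y) := by
  obtain ⟨σ, hσ, h0, rfl⟩ := hH
  obtain ⟨τ, hτ, h1, rfl⟩ := hK
  refine ⟨fun s => σ s + τ s, hσ.add hτ, fun s hs => by simp [h0 s hs, h1 s hs], ?_⟩
  exact (fourier_add_fun (integrable_of_smooth_of_eq_zero hσ.continuous h0)
    (integrable_of_smooth_of_eq_zero hτ.continuous h1)).symm

lemma const_mul (c : ℂ) (hH : IsBandLimited r H) : IsBandLimited r (fun y => c * H y) := by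
  obtain ⟨σ, hσ, h0, rfl⟩ := hH
  refine ⟨fun s => c * σ s, contDiff_const.mul hσ, fun s hs => by simp [h0 s hs], ?_⟩
  exact (fourier_const_mul_fun c σ).symm

lemma id_mul (hH : IsBandLimited r H) : IsBandLimited r (fun y => (y : ℂ) * H y) := by
  obtain ⟨σ, hσ, h0, rfl⟩ := hH
  have h1 : IsBandLimited r (𝓕 (_root_.deriv σ)) :=
    ⟨_root_.deriv σ, (contDiff_infty_iff_deriv.1 hσ).2, deriv_eq_zero_of_eq_zero h0, rfl⟩
  convert h1.const_mul (2 * π * Complex.I)⁻¹ using 2 with y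
  rw [Real.fourier_deriv (integrable_of_smooth_of_eq_zero hσ.continuous h0)
    (hσ.differentiable (by simp))
    (integrable_of_smooth_of_eq_zero (contDiff_infty_iff_deriv.1 hσ).2.continuous
      (deriv_eq_zero_of_eq_zero h0))]
  have : (π : ℂ) ≠ 0 := by exact_mod_cast pi_ne_zero
  have := Complex.I_ne_zero
  simp only [smul_eq_mul]
  field_simp

lemma pow_mul (n : ℕ) (hH : IsBandLimited r H) : IsBandLimited r (fun y => (y : ℂ) ^ n * H y) := by
  induction n with
  | zero => simpa using hH
  | succ n ih =>
    convert ih.id_mul using 2 with y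
    ring

lemma fourier_mul {w : ℝ → ℂ} {c : ℝ} (hw : Integrable w) (hw0 : ∀ s, c < |s| → w s = 0)
    (hH : IsBandLimited r H) : IsBandLimited (c + r) (fun y => 𝓕 w y * H y) := by
  obtain ⟨σ, hσ, h0, rfl⟩ := hH
  refine ⟨convolution w σ (ContinuousLinearMap.mul ℂ ℂ) volume, ?_, ?_, ?_⟩
  · have := (hasCompactSupport_of_eq_zero h0).contDiff_convolution_right
      (ContinuousLinearMap.mul ℝ ℂ) hw.locallyIntegrable (μ := volume) (n := ⊤) hσ
    exact this
  · intro s hs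
    rw [convolution_def]
    refine integral_eq_zero_of_ae (Eventually.of_forall fun t => ?_)
    by_cases ht : c < |t|
    · simp [hw0 t ht]
    · have : r < |s - t| := by
        have := abs_sub_abs_le_abs_sub s t
        linarith
      simp [h0 _ this]
  · ext y
    exact (Real.fourier_mul_convolution_eq hw
      (integrable_of_smooth_of_eq_zero hσ.continuous h0) y).symm

lemma mono {r' : ℝ} (h : r ≤ r') (hH : IsBandLimited r H) : IsBandLimited r' H := by
  obtain ⟨σ, hσ, h0, rfl⟩ := hH
  exact ⟨σ, hσ, fun s hs => h0 s (h.trans_lt hs), rfl⟩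

lemma differentiable (hH : IsBandLimited r H) : Differentiable ℝ H := by
  obtain ⟨f, rfl⟩ := hH.exists_schwartz
  exact f.differentiable

lemma continuous (hH : IsBandLimited r H) : Continuous H := hH.differentiable.continuous

lemma tendsto_zero (hH : IsBandLimited r H) : Tendsto H atTop (𝓝 0) := by
  obtain ⟨f, rfl⟩ := hH.exists_schwartz
  exact (zero_at_infty f).mono_left atTop_le_cocompact

lemma contDiff (hH : IsBandLimited r H) : ContDiff ℝ ∞ H := by
  obtain ⟨f, rfl⟩ := hH.exists_schwartz
  exact f.smooth'

lemma integrable (hH : IsBandLimited r H) : Integrable H := by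
  obtain ⟨f, rfl⟩ := hH.exists_schwartz
  exact f.integrable

lemma exists_odd_spectrum (hH : IsBandLimited r H) (hodd : ∀ y, H (-y) = -H y) :
    ∃ σ : ℝ → ℂ, ContDiff ℝ ∞ σ ∧ (∀ s, r < |s| → σ s = 0) ∧ (∀ s, σ (-s) = -σ s) ∧
      H = 𝓕 σ := by
  obtain ⟨σ, hσ, h0, rfl⟩ := hH
  have hi := integrable_of_smooth_of_eq_zero hσ.continuous h0
  refine ⟨fun s => (1 / 2 : ℂ) * (σ s + (-1) * σ (-s)), ?_, ?_, ?_, ?_⟩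
  · exact contDiff_const.mul (hσ.add (contDiff_const.mul (hσ.comp contDiff_neg)))
  · intro s hs
    simp [h0 s hs, h0 (-s) (by simpa using hs)]
  · intro s
    simp only [neg_neg]
    ring
  · rw [fourier_const_mul_fun, fourier_add_fun hi (hi.comp_neg.const_mul _),
      fourier_const_mul_fun, fourier_comp_neg]
    ext y
    simp only [hodd y]
    ring

end IsBandLimited

lemma hasDerivAt_inv_sqrt_one_sub_sq {s : ℝ} (hs : |s| < 1) :
    HasDerivAt (fun s : ℝ => (√(1 - s ^ 2))⁻¹) (s * ((√(1 - s ^ 2))⁻¹) ^ 3) s := by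
  have h1 : 0 < 1 - s ^ 2 := by
    have := (sq_lt_one_iff_abs_lt_one s).2 hs
    linarith
  have h2 := (((hasDerivAt_pow 2 s).const_sub 1).sqrt h1.ne').inv (Real.sqrt_pos.2 h1).ne'
  refine h2.congr_deriv ?_
  have h3 := Real.sq_sqrt h1.le
  have h4 := (Real.sqrt_pos.2 h1).ne'
  push_cast
  field_simp

lemma contDiff_inv_sqrt_mul {ρ : ℝ → ℂ} {r : ℝ} (hr : r < 1) (hρ : ContDiff ℝ ∞ ρ)
    (h0 : ∀ s, r < |s| → ρ s = 0) :
    ContDiff ℝ ∞ fun s : ℝ => (((√(1 - s ^ 2))⁻¹ : ℝ) : ℂ) * ρ s := by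
  rw [contDiff_iff_contDiffAt]
  intro s
  by_cases hs : |s| < 1
  · have h1 : 0 < 1 - s ^ 2 := by
      have := (sq_lt_one_iff_abs_lt_one s).2 hs
      linarith
    refine ContDiffAt.mul ?_ hρ.contDiffAt
    refine Complex.ofRealCLM.contDiff.contDiffAt.comp s ?_
    refine ContDiffAt.inv (ContDiffAt.sqrt ?_ h1.ne') (Real.sqrt_pos.2 h1).ne'
    fun_prop
  · have hs' : r < |s| := by linarith
    refine (contDiffAt_const (c := (0 : ℂ))).congr_of_eventuallyEq ?_
    filter_upwards [(isOpen_lt continuous_const continuous_abs).mem_nhds hs'] with t ht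
    simp [h0 t ht]

/-- The equation `(1 - s²) σ' - s σ = ρ` has a compactly supported solution for odd `ρ`
supported in `(-1, 1)`. -/
lemma exists_bessel_spectrum {ρ : ℝ → ℂ} {r : ℝ} (hr0 : 0 ≤ r) (hr : r < 1)
    (hρ : ContDiff ℝ ∞ ρ) (h0 : ∀ s, r < |s| → ρ s = 0) (hodd : ∀ s, ρ (-s) = -ρ s) :
    ∃ σ : ℝ → ℂ, ContDiff ℝ ∞ σ ∧ (∀ s, r < |s| → σ s = 0) ∧
      ∀ s : ℝ, (1 - (s : ℂ) ^ 2) * deriv σ s - s * σ s = ρ s := by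
  set w : ℝ → ℝ := fun s => (√(1 - s ^ 2))⁻¹ with hw
  set ρ₁ : ℝ → ℂ := fun s => (w s : ℂ) * ρ s with hρ₁
  have hρ₁s : ContDiff ℝ ∞ ρ₁ := contDiff_inv_sqrt_mul hr hρ h0
  have hρ₁0 : ∀ s, r < |s| → ρ₁ s = 0 := fun s hs => by simp [hρ₁, h0 s hs]
  have hρ₁odd : ∀ s, ρ₁ (-s) = -ρ₁ s := fun s => by simp [hρ₁, hw, hodd s]
  set τ : ℝ → ℂ := fun s => ∫ t in (-1 : ℝ)..s, ρ₁ t with hτ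
  have hτd : ∀ s, HasDerivAt τ (ρ₁ s) s := fun s =>
    intervalIntegral.integral_hasDerivAt_right (hρ₁s.continuous.intervalIntegrable _ _)
      (hρ₁s.continuous.stronglyMeasurableAtFilter _ _) hρ₁s.continuous.continuousAt
  have hτs : ContDiff ℝ ∞ τ := by
    rw [contDiff_infty_iff_deriv]
    refine ⟨fun s => (hτd s).differentiableAt, ?_⟩
    rwa [show deriv τ = ρ₁ from funext fun s => (hτd s).deriv]
  have hτneg : ∀ s, s < -r → τ s = 0 := by
    intro s hs
    refine (intervalIntegral.integral_congr (g := fun _ => 0) fun t ht => hρ₁0 t ?_).trans (by simp)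
    have : t < -r := lt_of_le_of_lt ht.2 (max_lt (by linarith) hs)
    rw [abs_of_neg (by linarith)]
    linarith
  have hτeven : ∀ s, τ s = τ (-s) := by
    intro s
    have h1 : ∫ t in (-s)..s, ρ₁ t = 0 := by
      have h2 := intervalIntegral.integral_comp_neg (a := -s) (b := s) ρ₁
      simp only [hρ₁odd, neg_neg, intervalIntegral.integral_neg] at h2
      exact self_eq_neg.1 h2.symm
    have h3 := intervalIntegral.integral_add_adjacent_intervals
      (hρ₁s.continuous.intervalIntegrable (μ := volume) (-1) (-s))
      (hρ₁s.continuous.intervalIntegrable (-s) s)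
    rw [h1, add_zero] at h3
    exact h3.symm
  have hτ0 : ∀ s, r < |s| → τ s = 0 := by
    intro s hs
    rcases le_total 0 s with h | h
    · rw [abs_of_nonneg h] at hs
      rw [hτeven]
      exact hτneg _ (by linarith)
    · rw [abs_of_nonpos h] at hs
      exact hτneg _ (by linarith)
  have hσ0 : ∀ s, r < |s| → (fun s => (w s : ℂ) * τ s) s = 0 := fun s hs => by simp [hτ0 s hs]
  refine ⟨fun s => (w s : ℂ) * τ s, contDiff_inv_sqrt_mul hr hτs hτ0, hσ0, fun s => ?_⟩
  by_cases hs : r < |s|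
  · simp [deriv_eq_zero_of_eq_zero hσ0 s hs, hτ0 s hs, h0 s hs]
  · have hs1 : |s| < 1 := by linarith
    have h1 : 0 < 1 - s ^ 2 := by
      have := (sq_lt_one_iff_abs_lt_one s).2 hs1
      linarith
    have hd : deriv (fun s => (w s : ℂ) * τ s) s = _ :=
      ((hasDerivAt_inv_sqrt_one_sub_sq hs1).ofReal_comp.mul (hτd s)).deriv
    rw [hd]
    have hw2 : (1 - (s : ℂ) ^ 2) * (w s : ℂ) ^ 2 = 1 := by
      have : (1 - s ^ 2) * w s ^ 2 = 1 := by
        simp only [hw]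
        rw [inv_pow, Real.sq_sqrt h1.le, mul_inv_cancel₀ h1.ne']
      exact_mod_cast this
    simp only [hρ₁]
    change (1 - (s : ℂ) ^ 2) * (((s * w s ^ 3 : ℝ) : ℂ) * τ s + (w s : ℂ) * ((w s : ℂ) * ρ s))
      - s * ((w s : ℂ) * τ s) = ρ s
    push_cast
    linear_combination (s * w s * τ s + ρ s) * hw2

namespace IsBandLimited

variable {r : ℝ} {H : ℝ → ℂ}

lemma tendsto_besselJ_mul (n : ℕ) (hH : IsBandLimited r H) :
    Tendsto (fun y : ℝ => (besselJ n (2 * π * y) : ℂ) * H y) atTop (𝓝 0) := by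
  obtain ⟨C, hC0, hC⟩ := besselJ_bounded n
  have h1 : Tendsto (fun y => C * ‖H y‖) atTop (𝓝 0) := by
    simpa using hH.tendsto_zero.norm.const_mul C
  refine squeeze_zero_norm' ?_ h1
  filter_upwards [eventually_ge_atTop 0] with y hy
  rw [norm_mul, Complex.norm_real]
  gcongr
  exact hC _ (by positivity)

lemma integrableOn_besselJ_mul (n : ℕ) (hH : IsBandLimited r H) :
    IntegrableOn (fun y : ℝ => (besselJ n (2 * π * y) : ℂ) * H y) (Set.Ioi 0) := by
  obtain ⟨C, hC0, hC⟩ := besselJ_bounded n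
  refine Integrable.bdd_mul (c := C) hH.integrable.integrableOn ?_ ?_
  · refine Continuous.aestronglyMeasurable ?_
    exact Complex.continuous_ofReal.comp ((continuous_besselJ n).comp (by fun_prop))
  · refine (ae_restrict_iff' measurableSet_Ioi).2 (Eventually.of_forall fun y hy => ?_)
    rw [Complex.norm_real]
    exact hC _ (by have : 0 < y := hy; positivity)

end IsBandLimited

lemma hasDerivAt_besselJ_two_pi_zero (y : ℝ) :
    HasDerivAt (fun y : ℝ => (besselJ 0 (2 * π * y) : ℂ))
      (-(2 * π * besselJ 1 (2 * π * y) : ℂ)) y := by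
  have h := ((hasDerivAt_besselJ_zero (2 * π * y)).comp y
    ((hasDerivAt_id y).const_mul (2 * π))).ofReal_comp
  refine h.congr_deriv ?_
  push_cast
  ring

lemma hasDerivAt_besselJ_two_pi_succ (n : ℕ) (y : ℝ) :
    HasDerivAt (fun y : ℝ => (besselJ (n + 1) (2 * π * y) : ℂ))
      (π * (besselJ n (2 * π * y) - besselJ (n + 2) (2 * π * y)) : ℂ) y := by
  have h := ((hasDerivAt_besselJ_succ n (2 * π * y)).comp y
    ((hasDerivAt_id y).const_mul (2 * π))).ofReal_comp
  refine h.congr_deriv ?_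
  push_cast
  ring

namespace IsBandLimited

variable {r : ℝ} {H : ℝ → ℂ}

/-- An odd band-limited function is the image of a band-limited function under the Bessel operator
`K ↦ y K'' + K' + 4π² y K`. -/
lemma exists_bessel_operator (hr : r < 1) (hH : IsBandLimited r H) (hodd : ∀ y, H (-y) = -H y) :
    ∃ K : ℝ → ℂ, IsBandLimited (max r 0) K ∧ ∀ y : ℝ,
      y * _root_.deriv (_root_.deriv K) y + _root_.deriv K y + 4 * π ^ 2 * (y * K y) = H y := by
  obtain ⟨ρ, hρ, h0, hρodd, rfl⟩ := (hH.mono (le_max_left r 0)).exists_odd_spectrum hodd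
  obtain ⟨σ, hσ, hσ0, hode⟩ := exists_bessel_spectrum (le_max_right r 0)
    (max_lt hr one_pos) hρ h0 hρodd
  have hσi := integrable_of_smooth_of_eq_zero hσ.continuous hσ0
  have hρi := integrable_of_smooth_of_eq_zero hρ.continuous h0
  have hcoe : ContDiff ℝ ∞ fun s : ℝ => (s : ℂ) := Complex.ofRealCLM.contDiff
  have hσ1 : ContDiff ℝ ∞ fun s : ℝ => (s : ℂ) * σ s := hcoe.mul hσ
  have hσ10 : ∀ s : ℝ, max r 0 < |s| → (s : ℂ) * σ s = 0 := fun s hs => by simp [hσ0 s hs]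
  have hσ1i := integrable_of_smooth_of_eq_zero hσ1.continuous hσ10
  have hσ2 : ContDiff ℝ ∞ fun s : ℝ => (s : ℂ) * ((s : ℂ) * σ s) := hcoe.mul hσ1
  have hσ20 : ∀ s : ℝ, max r 0 < |s| → (s : ℂ) * ((s : ℂ) * σ s) = 0 :=
    fun s hs => by simp [hσ0 s hs]
  have hσ2i := integrable_of_smooth_of_eq_zero hσ2.continuous hσ20
  have hd1 : _root_.deriv (𝓕 σ) = fun y => (-2 * π * Complex.I) * 𝓕 (fun s : ℝ => s * σ s) y := by
    rw [Real.deriv_fourier hσi (by simpa using hσ1i), ← fourier_const_mul_fun]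
    congr 1
    ext s
    simp only [smul_eq_mul]
    ring
  have hd2 : _root_.deriv (_root_.deriv (𝓕 σ)) = fun y => (-2 * π * Complex.I) *
      ((-2 * π * Complex.I) * 𝓕 (fun s : ℝ => s * (s * σ s)) y) := by
    rw [hd1]
    ext y
    rw [deriv_const_mul_field, Real.deriv_fourier hσ1i (by simpa using hσ2i)]
    congr 1
    rw [← congrFun (fourier_const_mul_fun (-2 * π * Complex.I) _) y]
    refine congrFun (congrArg _ (funext fun s => ?_)) y
    simp only [smul_eq_mul]
    ring
  set f : ℝ → ℂ := fun s => σ s + (-1) * (s * (s * σ s)) with hf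
  have hfs : ContDiff ℝ ∞ f := hσ.add (contDiff_const.mul hσ2)
  have hf0 : ∀ s, max r 0 < |s| → f s = 0 := fun s hs => by simp [hf, hσ0 s hs]
  have hfd : _root_.deriv f = fun s => ρ s + (-1) * (s * σ s) := by
    ext s
    have h1 := (hσ.differentiable (by simp) s).hasDerivAt
    have h2 : HasDerivAt (fun s : ℝ => (s : ℂ)) 1 s := (hasDerivAt_id s).ofReal_comp
    have h3 : _root_.deriv f s = _ := (h1.add ((h2.mul (h2.mul h1)).const_mul (-1))).deriv
    rw [h3, ← hode s]
    simp only [Pi.mul_apply]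
    ring
  have hFf : 𝓕 f = fun y => 𝓕 σ y + (-1) * 𝓕 (fun s : ℝ => s * (s * σ s)) y := by
    rw [hf, fourier_add_fun hσi (hσ2i.const_mul _), fourier_const_mul_fun]
  have hFd := Real.fourier_deriv (integrable_of_smooth_of_eq_zero hfs.continuous hf0)
    (hfs.differentiable (by simp)) (by rw [hfd]; exact hρi.add (hσ1i.const_mul _))
  rw [hfd, fourier_add_fun hρi (hσ1i.const_mul _), fourier_const_mul_fun, hFf] at hFd
  have hK : IsBandLimited (max r 0) (𝓕 σ) := ⟨σ, hσ, hσ0, rfl⟩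
  refine ⟨fun y => (Complex.I / (2 * π)) * 𝓕 σ y, hK.const_mul _, fun y => ?_⟩
  have h3 : _root_.deriv (fun y => (Complex.I / (2 * π)) * 𝓕 σ y) =
      fun y => (Complex.I / (2 * π)) * _root_.deriv (𝓕 σ) y := by
    ext y
    rw [deriv_const_mul_field]
  rw [h3, deriv_const_mul_field, hd2, hd1]
  have h4 := congrFun hFd y
  simp only [smul_eq_mul] at h4 ⊢
  have hπ : (π : ℂ) ≠ 0 := by exact_mod_cast pi_ne_zero
  have hu : Complex.I / (2 * π) * (-2 * π * Complex.I) = 1 := by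
    field_simp
    rw [Complex.I_sq]
    ring
  have hv : (-2 * π * Complex.I) ^ 2 = -(4 * π ^ 2 : ℂ) := by
    rw [mul_pow, Complex.I_sq]
    ring
  generalize 𝓕 σ y = A at *
  generalize 𝓕 (fun s : ℝ => s * (s * σ s)) y = B at *
  generalize 𝓕 (fun s : ℝ => s * σ s) y = D at *
  generalize 𝓕 ρ y = R at *
  linear_combination (y * (-2 * π * Complex.I) * B + D - (-2 * π * Complex.I) * y * A) * hu +
    (Complex.I / (2 * π) * y * A) * hv - h4

/-- `∫₀^∞ J₀(2πy) H(y) dy = 0` for odd band-limited `H`. -/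
lemma integral_besselJ_zero_mul (hr : r < 1) (hH : IsBandLimited r H)
    (hodd : ∀ y, H (-y) = -H y) :
    ∫ y in Set.Ioi (0 : ℝ), (besselJ 0 (2 * π * y) : ℂ) * H y = 0 := by
  obtain ⟨K, hK, hop⟩ := hH.exists_bessel_operator hr hodd
  have hderiv : ∀ y ∈ Set.Ici (0 : ℝ), HasDerivAt
      (fun y : ℝ => (besselJ 0 (2 * π * y) : ℂ) * (y * _root_.deriv K y) +
        2 * π * ((besselJ 1 (2 * π * y) : ℂ) * (y * K y)))
      ((besselJ 0 (2 * π * y) : ℂ) * H y) y := by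
    intro y _
    have h2 : HasDerivAt (fun s : ℝ => (s : ℂ)) 1 y := (hasDerivAt_id y).ofReal_comp
    have hK1 := (hK.differentiable y).hasDerivAt
    have hK2 := (hK.deriv.differentiable y).hasDerivAt
    have h := ((hasDerivAt_besselJ_two_pi_zero y).mul (h2.mul hK2)).add
      (((hasDerivAt_besselJ_two_pi_succ 0 y).mul (h2.mul hK1)).const_mul (2 * π : ℂ))
    refine h.congr_deriv ?_
    rw [← hop y]
    have hrec : (2 * besselJ 1 (2 * π * y) : ℂ) =
        2 * π * y * (besselJ 0 (2 * π * y) + besselJ 2 (2 * π * y)) := by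
      have := besselJ_recurrence 0 (2 * π * y)
      simp only [Nat.cast_zero, zero_add, mul_one] at this
      exact_mod_cast this
    simp only [Pi.mul_apply, zero_add]
    linear_combination (π * K y) * hrec
  rw [integral_Ioi_of_hasDerivAt_of_tendsto' (m := 0) hderiv (hH.integrableOn_besselJ_mul 0)]
  · simp
  · simpa using (hK.deriv.id_mul.tendsto_besselJ_mul 0).add
      ((hK.id_mul.tendsto_besselJ_mul 1).const_mul (2 * π : ℂ))

/-- `∫₀^∞ J₁(2πy) H(y) dy = H(0) / 2π` for even band-limited `H`. -/
lemma integral_besselJ_one_mul (hr : r < 1) (hH : IsBandLimited r H)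
    (heven : ∀ y, H (-y) = H y) :
    ∫ y in Set.Ioi (0 : ℝ), (besselJ 1 (2 * π * y) : ℂ) * H y = H 0 / (2 * π) := by
  have hodd : ∀ y, _root_.deriv H (-y) = -_root_.deriv H y := by
    intro y
    have := deriv_comp_neg H y
    simp only [heven] at this
    simp [this]
  have h0 := hH.deriv.integral_besselJ_zero_mul hr hodd
  have hderiv : ∀ y ∈ Set.Ici (0 : ℝ), HasDerivAt
      (fun y : ℝ => (besselJ 0 (2 * π * y) : ℂ) * H y)
      (-(2 * π) * ((besselJ 1 (2 * π * y) : ℂ) * H y) +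
        (besselJ 0 (2 * π * y) : ℂ) * _root_.deriv H y) y := by
    intro y _
    refine ((hasDerivAt_besselJ_two_pi_zero y).mul
      (hH.differentiable y).hasDerivAt).congr_deriv ?_
    ring
  have hi1 := (hH.integrableOn_besselJ_mul 1).const_mul (-(2 * π : ℂ))
  have hi0 := hH.deriv.integrableOn_besselJ_mul 0
  have h := integral_Ioi_of_hasDerivAt_of_tendsto' (m := 0) hderiv (hi1.add hi0)
    (hH.tendsto_besselJ_mul 0)
  rw [integral_add hi1 hi0, integral_const_mul, h0] at h
  have hπ : (π : ℂ) ≠ 0 := by exact_mod_cast pi_ne_zero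
  simp only [mul_zero, besselJ_zero_zero, Complex.ofReal_one, one_mul, add_zero, zero_sub] at h
  rw [eq_div_iff (by simp [hπ])]
  linear_combination -h

lemma integral_besselJ_add_two_mul (n : ℕ) (hH : IsBandLimited r H) :
    ∫ y in Set.Ioi (0 : ℝ), (besselJ (n + 2) (2 * π * y) : ℂ) * H y =
      (∫ y in Set.Ioi (0 : ℝ), (besselJ n (2 * π * y) : ℂ) * H y) +
        (1 / π) * ∫ y in Set.Ioi (0 : ℝ),
          (besselJ (n + 1) (2 * π * y) : ℂ) * _root_.deriv H y := by
  have hderiv : ∀ y ∈ Set.Ici (0 : ℝ), HasDerivAt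
      (fun y : ℝ => (besselJ (n + 1) (2 * π * y) : ℂ) * H y)
      (π * ((besselJ n (2 * π * y) : ℂ) * H y) - π * ((besselJ (n + 2) (2 * π * y) : ℂ) * H y) +
        (besselJ (n + 1) (2 * π * y) : ℂ) * _root_.deriv H y) y := by
    intro y _
    refine ((hasDerivAt_besselJ_two_pi_succ n y).mul
      (hH.differentiable y).hasDerivAt).congr_deriv ?_
    ring
  have hi1 := (hH.integrableOn_besselJ_mul n).const_mul (π : ℂ)
  have hi2 := (hH.integrableOn_besselJ_mul (n + 2)).const_mul (π : ℂ)
  have hi0 := hH.deriv.integrableOn_besselJ_mul (n + 1)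
  have h := integral_Ioi_of_hasDerivAt_of_tendsto' (m := 0) hderiv ((hi1.sub hi2).add hi0)
    (hH.tendsto_besselJ_mul (n + 1))
  have hadd := integral_add (hi1.sub hi2) hi0
  have hsub := integral_sub hi1 hi2
  simp only [Pi.sub_apply] at hadd
  rw [hadd, hsub, integral_const_mul, integral_const_mul] at h
  have hπ : (π : ℂ) ≠ 0 := by exact_mod_cast pi_ne_zero
  simp only [mul_zero, besselJ_succ_zero, Complex.ofReal_zero, zero_mul, sub_zero] at h
  field_simp
  linear_combination -h

end IsBandLimited

lemma iteratedDeriv_id_mul {F : ℝ → ℂ} (hF : ContDiff ℝ ∞ F) (k : ℕ) (y : ℝ) :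
    iteratedDeriv (k + 1) (fun y : ℝ => (y : ℂ) * F y) y =
      y * iteratedDeriv (k + 1) F y + (k + 1) * iteratedDeriv k F y := by
  induction k generalizing y with
  | zero =>
    have hd := (((hasDerivAt_id y).ofReal_comp).mul
      (hF.differentiable (by simp) y).hasDerivAt)
    have hd' : deriv (fun y : ℝ => (y : ℂ) * F y) y = _ := hd.deriv
    simp only [zero_add, iteratedDeriv_one, hd', iteratedDeriv_zero]
    simp [add_comm]
  | succ k ih =>
    rw [iteratedDeriv_succ, funext ih]
    have h1 : ∀ j, HasDerivAt (iteratedDeriv j F) (iteratedDeriv (j + 1) F y) y := by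
      intro j
      rw [iteratedDeriv_succ]
      exact ((hF.differentiable_iteratedDeriv j (by exact_mod_cast WithTop.coe_lt_top _)) y).hasDerivAt
    have hd := (((hasDerivAt_id y).ofReal_comp).mul (h1 (k + 1))).add
      ((h1 k).const_mul ((k : ℂ) + 1))
    have hd' : deriv (fun y : ℝ => (y : ℂ) * iteratedDeriv (k + 1) F y +
      ((k : ℂ) + 1) * iteratedDeriv k F y) y = _ := hd.deriv
    rw [hd']
    push_cast
    simp
    ring

lemma contDiff_ofReal_pow_mul {F : ℝ → ℂ} (hF : ContDiff ℝ ∞ F) (n : ℕ) :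
    ContDiff ℝ ∞ (fun y : ℝ => (y : ℂ) ^ n * F y) :=
  (Complex.ofRealCLM.contDiff.pow n).mul hF

lemma iteratedDeriv_pow_mul_zero_of_lt {F : ℝ → ℂ} (hF : ContDiff ℝ ∞ F) {n i : ℕ} (hi : i < n) :
    iteratedDeriv i (fun y : ℝ => (y : ℂ) ^ n * F y) 0 = 0 := by
  induction n generalizing i with
  | zero => omega
  | succ n ih =>
    have h : (fun y : ℝ => (y : ℂ) ^ (n + 1) * F y) = fun y : ℝ => (y : ℂ) * ((y : ℂ) ^ n * F y) := by
      ext y; ring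
    rw [h]
    cases i with
    | zero => simp
    | succ i =>
      rw [iteratedDeriv_id_mul (contDiff_ofReal_pow_mul hF n), ih (Nat.lt_of_succ_lt_succ hi)]
      simp

lemma iteratedDeriv_pow_mul_zero {F : ℝ → ℂ} (hF : ContDiff ℝ ∞ F) (n j : ℕ) :
    iteratedDeriv (n + j) (fun y : ℝ => (y : ℂ) ^ n * F y) 0 =
      ((n + j).factorial / j.factorial : ℂ) * iteratedDeriv j F 0 := by
  induction n with
  | zero =>
    have : (j.factorial : ℂ) ≠ 0 := by exact_mod_cast j.factorial_ne_zero
    simp [this]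
  | succ n ih =>
    have h : (fun y : ℝ => (y : ℂ) ^ (n + 1) * F y) = fun y : ℝ => (y : ℂ) * ((y : ℂ) ^ n * F y) := by
      ext y; ring
    rw [h, show n + 1 + j = n + j + 1 by ring, iteratedDeriv_id_mul (contDiff_ofReal_pow_mul hF n), ih,
      Nat.factorial_succ]
    push_cast
    ring

lemma deriv_parity {H : ℝ → ℂ} {c : ℂ} (hpar : ∀ y, H (-y) = c * H y) (y : ℝ) :
    deriv H (-y) = -c * deriv H y := by
  have := deriv_comp_neg H y
  simp only [hpar] at this
  rw [deriv_const_mul_field] at this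
  linear_combination this

namespace IsBandLimited
variable {r : ℝ} {H : ℝ → ℂ}

lemma integral_besselJ_mul_eq_zero (hr : r < 1) (n : ℕ) (hH : IsBandLimited r H)
    (hpar : ∀ y, H (-y) = (-1) ^ (n + 1) * H y) (h0 : ∀ i < n, iteratedDeriv i H 0 = 0) :
    ∫ y in Set.Ioi (0 : ℝ), (besselJ n (2 * π * y) : ℂ) * H y = 0 := by
  induction n using Nat.twoStepInduction generalizing H with
  | zero => exact hH.integral_besselJ_zero_mul hr (by simpa using hpar)
  | one =>
    rw [hH.integral_besselJ_one_mul hr (by simpa using hpar)]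
    have := h0 0 (by norm_num)
    simp only [iteratedDeriv_zero] at this
    simp [this]
  | more n ih1 ih2 =>
    rw [integral_besselJ_add_two_mul n hH,
      ih1 hH (fun y => by rw [hpar]; ring) (fun i hi => h0 i (by omega)),
      ih2 hH.deriv (fun y => by rw [deriv_parity hpar]; ring)
        (fun i hi => by rw [← iteratedDeriv_succ']; exact h0 _ (by omega))]
    simp

lemma integral_besselJ_succ_mul (hr : r < 1) (n : ℕ) (hH : IsBandLimited r H)
    (hpar : ∀ y, H (-y) = (-1) ^ n * H y) (h0 : ∀ i < n, iteratedDeriv i H 0 = 0) :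
    ∫ y in Set.Ioi (0 : ℝ), (besselJ (n + 1) (2 * π * y) : ℂ) * H y =
      (1 / π) ^ n * iteratedDeriv n H 0 / (2 * π) := by
  induction n generalizing H with
  | zero => simpa using hH.integral_besselJ_one_mul hr (by simpa using hpar)
  | succ n ih =>
    rw [integral_besselJ_add_two_mul n hH,
      hH.integral_besselJ_mul_eq_zero hr n hpar (fun i hi => h0 i (by omega)),
      ih hH.deriv (fun y => by rw [deriv_parity hpar]; ring)
        (fun i hi => by rw [← iteratedDeriv_succ']; exact h0 _ (by omega)), ← iteratedDeriv_succ']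
    ring

lemma integral_besselJ_add_three_mul (hr : r < 1) (n : ℕ) (hH : IsBandLimited r H)
    (hpar : ∀ y, H (-y) = (-1) ^ n * H y) (h0 : ∀ i < n, iteratedDeriv i H 0 = 0) :
    ∫ y in Set.Ioi (0 : ℝ), (besselJ (n + 3) (2 * π * y) : ℂ) * H y =
      ((n + 1) * (1 / π) ^ n * iteratedDeriv n H 0 +
        (1 / π) ^ (n + 2) * iteratedDeriv (n + 2) H 0) / (2 * π) := by
  induction n generalizing H with
  | zero =>
    have hp : ∀ y, _root_.deriv H (-y) = -1 * _root_.deriv H y := fun y => by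
      rw [deriv_parity hpar]; simp
    have hd0 : _root_.deriv H 0 = 0 := by
      have := hp 0
      rw [neg_zero] at this
      linear_combination this / 2
    rw [integral_besselJ_add_two_mul _ hH, hH.integral_besselJ_one_mul hr (by simpa using hpar),
      integral_besselJ_succ_mul hr 1 hH.deriv (by simpa using hp) (by simpa using hd0),
      ← iteratedDeriv_succ']
    simp
    ring
  | succ n ih =>
    rw [integral_besselJ_add_two_mul _ hH, integral_besselJ_succ_mul hr (n + 1) hH hpar h0,
      ih hH.deriv (fun y => by rw [deriv_parity hpar]; ring)
        (fun i hi => by rw [← iteratedDeriv_succ']; exact h0 _ (by omega)), ← iteratedDeriv_succ',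
        ← iteratedDeriv_succ']
    push_cast
    ring

/-- The two-term Hankel formula for even band-limited functions. -/
lemma integral_pow_mul_besselJ_mul (hr : r < 1) (m : ℕ) (hH : IsBandLimited r H)
    (heven : ∀ y, H (-y) = H y) :
    ∫ y in Set.Ioi (0 : ℝ), (besselJ (2 * m + 3) (2 * π * y) : ℂ) * ((y : ℂ) ^ (2 * m) * H y) =
      (2 * m + 1).factorial / (2 * π ^ (2 * m + 1)) *
        (H 0 + (m + 1) / π ^ 2 * iteratedDeriv 2 H 0) := by
  have hπ : (π : ℂ) ≠ 0 := by exact_mod_cast pi_ne_zero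
  rw [integral_besselJ_add_three_mul hr (2 * m) (hH.pow_mul (2 * m))
    (fun y => by simp [heven])
    (fun i hi => iteratedDeriv_pow_mul_zero_of_lt hH.contDiff hi),
    iteratedDeriv_pow_mul_zero hH.contDiff (2 * m) 2]
  have := iteratedDeriv_pow_mul_zero hH.contDiff (2 * m) 0
  rw [add_zero] at this
  rw [this, Nat.factorial_succ (2 * m + 1), Nat.factorial_succ (2 * m)]
  simp only [iteratedDeriv_zero, one_div, inv_pow]
  push_cast
  simp only [Nat.factorial_zero, Nat.factorial_two, Nat.cast_one, Nat.cast_ofNat]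
  field_simp
  ring

end IsBandLimited

/-- The cosine transform `∫ cos(πt)^q cos(2πtx) dt` over `[-1/2, 1/2]`. -/
noncomputable def cosPowTransform (q x : ℝ) : ℝ :=
  ∫ t in (-(1 / 2) : ℝ)..(1 / 2), cos (π * t) ^ q * cos (2 * π * t * x)

lemma cos_pi_mul_nonneg {t : ℝ} (ht : |t| ≤ 1 / 2) : 0 ≤ cos (π * t) := by
  rw [abs_le] at ht
  apply cos_nonneg_of_mem_Icc
  constructor <;> nlinarith [pi_pos]

lemma continuous_cos_pi_mul_rpow {q : ℝ} (hq : 0 ≤ q) : Continuous fun t : ℝ => cos (π * t) ^ q :=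
  (by fun_prop : Continuous fun t : ℝ => cos (π * t)).rpow_const fun _ => Or.inr hq

lemma cosPowTransform_recurrence {q : ℝ} (hq : 0 ≤ q) (x : ℝ) :
    ((q + 2) ^ 2 - 4 * x ^ 2) * cosPowTransform (q + 2) x =
      (q + 2) * (q + 1) * cosPowTransform q x := by
  have hderiv : ∀ t ∈ Set.uIcc (-(1 / 2) : ℝ) (1 / 2), HasDerivAt
      (fun t : ℝ => (1 / π) * ((q + 2) * (cos (π * t) ^ (q + 1) * (sin (π * t) * cos (2 * π * t * x))) -
        2 * x * (cos (π * t) ^ (q + 2) * sin (2 * π * t * x))))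
      (((q + 2) ^ 2 - 4 * x ^ 2) * (cos (π * t) ^ (q + 2) * cos (2 * π * t * x)) -
        (q + 2) * (q + 1) * (cos (π * t) ^ q * cos (2 * π * t * x))) t := by
    intro t ht
    rw [Set.uIcc_of_le (by norm_num), Set.mem_Icc, ← abs_le] at ht
    have hc0 := cos_pi_mul_nonneg ht
    have hl : HasDerivAt (fun t : ℝ => π * t) π t := by
      simpa using (hasDerivAt_id t).const_mul π
    have hl2 : HasDerivAt (fun t : ℝ => 2 * π * t * x) (2 * π * x) t := by
      simpa using ((hasDerivAt_id t).const_mul (2 * π)).mul_const x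
    have h1 : HasDerivAt (fun t : ℝ => cos (π * t) ^ (q + 1)) _ t :=
      hl.cos.rpow_const (p := q + 1) (Or.inr (by linarith))
    have h2 : HasDerivAt (fun t : ℝ => cos (π * t) ^ (q + 2)) _ t :=
      hl.cos.rpow_const (p := q + 2) (Or.inr (by linarith))
    refine ((((h1.mul (hl.sin.mul hl2.cos)).const_mul (q + 2)).sub
      ((h2.mul hl2.sin).const_mul (2 * x))).const_mul (1 / π)).congr_deriv ?_
    have e1 : cos (π * t) ^ (q + 1) = cos (π * t) ^ q * cos (π * t) :=
      rpow_add_one' hc0 (by linarith)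
    have e2 : cos (π * t) ^ (q + 2) = cos (π * t) ^ (q + 1) * cos (π * t) := by
      rw [← rpow_add_one' hc0 (by linarith)]; ring_nf
    have e3 : q + 2 - 1 = q + 1 := by ring
    have e4 : q + 1 - 1 = q := by ring
    simp only [Pi.mul_apply, e3, e4, e2, e1]
    have hs := sin_sq_add_cos_sq (π * t)
    generalize cos (π * t) = c at *
    generalize sin (π * t) = s at *
    generalize cos (2 * π * t * x) = C at *
    generalize sin (2 * π * t * x) = S at *
    generalize c ^ q = P at *
    have hπ := pi_ne_zero
    field_simp
    linear_combination (-(q + 2) * P * C * (q + 1)) * hs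
  have hi1 : IntervalIntegrable (fun t => ((q + 2) ^ 2 - 4 * x ^ 2) *
      (cos (π * t) ^ (q + 2) * cos (2 * π * t * x))) volume (-(1 / 2)) (1 / 2) :=
    (((continuous_cos_pi_mul_rpow (by linarith)).mul (by fun_prop)).const_mul _).intervalIntegrable _ _
  have hi2 : IntervalIntegrable (fun t => (q + 2) * (q + 1) *
      (cos (π * t) ^ q * cos (2 * π * t * x))) volume (-(1 / 2)) (1 / 2) :=
    (((continuous_cos_pi_mul_rpow hq).mul (by fun_prop)).const_mul _).intervalIntegrable _ _
  have h := intervalIntegral.integral_eq_sub_of_hasDerivAt hderiv (hi1.sub hi2)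
  rw [intervalIntegral.integral_sub hi1 hi2, intervalIntegral.integral_const_mul,
    intervalIntegral.integral_const_mul] at h
  have z1 : cos (π * (1 / 2)) = 0 := by rw [mul_one_div, cos_pi_div_two]
  have z2 : cos (π * -(1 / 2)) = 0 := by rw [mul_neg, cos_neg, z1]
  rw [z1, z2, zero_rpow (by linarith), zero_rpow (by linarith)] at h
  unfold cosPowTransform
  linear_combination h

lemma cosPowTransform_zero_pos {q : ℝ} (hq : 0 ≤ q) : 0 < cosPowTransform q 0 := by
  unfold cosPowTransform
  apply intervalIntegral.intervalIntegral_pos_of_pos_on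
  · exact ((continuous_cos_pi_mul_rpow hq).mul (by fun_prop)).intervalIntegrable _ _
  · intro t ht
    have : 0 < cos (π * t) := by
      apply cos_pos_of_mem_Ioo
      constructor <;> nlinarith [pi_pos, ht.1, ht.2]
    simp
    positivity
  · norm_num

lemma four_mul_sq_le_sin_pi_mul_sq {t : ℝ} (ht : |t| ≤ 1 / 2) : 4 * t ^ 2 ≤ sin (π * t) ^ 2 := by
  have h : 2 / π * |π * t| ≤ |sin (π * t)| := by
    apply mul_abs_le_abs_sin
    rw [abs_mul, abs_of_pos pi_pos]
    nlinarith [pi_pos]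
  rw [abs_mul, abs_of_pos pi_pos] at h
  have h2 : 2 * |t| ≤ |sin (π * t)| := by
    refine le_trans (le_of_eq ?_) h
    have := pi_ne_zero
    field_simp
  have := pow_le_pow_left₀ (by positivity) h2 2
  rw [mul_pow, sq_abs, sq_abs] at this
  linarith

lemma cosPowTransform_close {q : ℝ} (hq : 0 ≤ q) (x : ℝ) :
    |cosPowTransform q x / cosPowTransform q 0 - 1| ≤ (π ^ 2 * x ^ 2 / 2) / (q + 2) := by
  have hc : ∀ q' : ℝ, 0 ≤ q' → ∀ y : ℝ, IntervalIntegrable (fun t => cos (π * t) ^ q' * cos (2 * π * t * y))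
      volume (-(1 / 2)) (1 / 2) := fun q' hq' y =>
    ((continuous_cos_pi_mul_rpow hq').mul (by fun_prop)).intervalIntegrable _ _
  have hpos := cosPowTransform_zero_pos hq
  have hrec := cosPowTransform_recurrence hq 0
  have hup : cosPowTransform q x ≤ cosPowTransform q 0 := by
    refine intervalIntegral.integral_mono_on (by norm_num) (hc q hq x) (hc q hq 0) fun t ht => ?_
    have := cos_pi_mul_nonneg (abs_le.2 ht)
    simp only [mul_zero, cos_zero]
    exact mul_le_mul_of_nonneg_left (cos_le_one _) (by positivity)
  have hlow : cosPowTransform q 0 - cosPowTransform q x ≤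
      (π ^ 2 * x ^ 2 / 2) * (cosPowTransform q 0 - cosPowTransform (q + 2) 0) := by
    unfold cosPowTransform
    rw [← intervalIntegral.integral_sub (hc q hq 0) (hc q hq x),
      ← intervalIntegral.integral_sub (hc q hq 0) (hc _ (by linarith) 0),
      ← intervalIntegral.integral_const_mul]
    refine intervalIntegral.integral_mono_on (by norm_num) ((hc q hq 0).sub (hc q hq x))
      (((hc q hq 0).sub (hc _ (by linarith) 0)).const_mul _) fun t ht => ?_
    have h0 := cos_pi_mul_nonneg (abs_le.2 ht)
    have e : cos (π * t) ^ (q + 2) = cos (π * t) ^ q * cos (π * t) ^ 2 := by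
      rw [show q + 2 = q + 1 + 1 by ring, rpow_add_one' h0 (by linarith),
        rpow_add_one' h0 (by linarith)]
      ring
    have hP : 0 ≤ cos (π * t) ^ q := by positivity
    rw [e]
    simp only [mul_zero, cos_zero, mul_one]
    have h1 := one_sub_sq_div_two_le_cos (x := 2 * π * t * x)
    have h2 := four_mul_sq_le_sin_pi_mul_sq (abs_le.2 ht)
    have h3 := sin_sq_add_cos_sq (π * t)
    have h4 : 1 - cos (2 * π * t * x) ≤ (π ^ 2 * x ^ 2 / 2) * (1 - cos (π * t) ^ 2) := by
      rw [← eq_sub_iff_add_eq] at h3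
      rw [← h3]
      have := mul_le_mul_of_nonneg_left h2 (show 0 ≤ π ^ 2 * x ^ 2 / 2 by positivity)
      nlinarith
    have := mul_le_mul_of_nonneg_left h4 hP
    linarith
  have hdiff : cosPowTransform q 0 - cosPowTransform (q + 2) 0 = cosPowTransform q 0 / (q + 2) := by
    have : q + 2 ≠ 0 := by linarith
    field_simp
    apply mul_left_cancel₀ this
    linear_combination -hrec
  rw [div_sub_one hpos.ne', abs_div, abs_of_pos hpos, abs_sub_comm, abs_of_nonneg (by linarith),
    div_le_iff₀ hpos]
  rw [hdiff] at hlow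
  refine hlow.trans (le_of_eq ?_)
  ring

/-- The normalised cosine transform. -/
noncomputable def cosPowRatio (a x : ℝ) : ℝ :=
  cosPowTransform (2 * a - 2) x / cosPowTransform (2 * a - 2) 0

lemma cosPowRatio_succ {a : ℝ} (ha : 1 ≤ a) (x : ℝ) :
    cosPowRatio a x = (a + x) * (a - x) / (a * a) * cosPowRatio (a + 1) x := by
  have h := cosPowTransform_recurrence (q := 2 * a - 2) (by linarith) x
  have h0 := cosPowTransform_recurrence (q := 2 * a - 2) (by linarith) 0
  have p0 := (cosPowTransform_zero_pos (q := 2 * a - 2) (by linarith)).ne'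
  have p1 := (cosPowTransform_zero_pos (q := 2 * a - 2 + 2) (by linarith)).ne'
  unfold cosPowRatio
  rw [show 2 * (a + 1) - 2 = 2 * a - 2 + 2 by ring]
  generalize cosPowTransform (2 * a - 2 + 2) x = A at *
  generalize cosPowTransform (2 * a - 2 + 2) 0 = B at *
  generalize cosPowTransform (2 * a - 2) x = C at *
  generalize cosPowTransform (2 * a - 2) 0 = D at *
  have ha0 : a ≠ 0 := by linarith
  have hk : 2 * a * (2 * a - 1) ≠ 0 := mul_ne_zero (by linarith) (by linarith)
  field_simp
  apply mul_left_cancel₀ hk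
  linear_combination (-B * a ^ 2) * h + (A * (a ^ 2 - x ^ 2)) * h0

lemma cosPowRatio_tendsto (a x : ℝ) :
    Tendsto (fun n : ℕ => cosPowRatio (a + n) x) atTop (𝓝 1) := by
  have h2 : Tendsto (fun n : ℕ => (π ^ 2 * x ^ 2 / 2) / (2 * (a + n) - 2 + 2)) atTop (𝓝 0) := by
    apply Tendsto.const_div_atTop
    have := (tendsto_natCast_atTop_atTop (R := ℝ)).const_mul_atTop (show (0 : ℝ) < 2 by norm_num)
    refine (tendsto_atTop_add_const_left _ (2 * a) this).congr fun n => by ring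
  rw [tendsto_iff_norm_sub_tendsto_zero]
  refine squeeze_zero' (Eventually.of_forall fun _ => norm_nonneg _) ?_ h2
  filter_upwards [(tendsto_natCast_atTop_atTop (R := ℝ)).eventually_ge_atTop (1 - a)] with n hn
  exact cosPowTransform_close (by linarith) x

lemma cosPowRatio_eq_prod {a : ℝ} (ha : 1 ≤ a) (x : ℝ) (n : ℕ) :
    cosPowRatio a x = (∏ j ∈ Finset.range n, ((a + x + j) * (a - x + j) / ((a + j) * (a + j)))) *
      cosPowRatio (a + n) x := by
  induction n with
  | zero => simp
  | succ n ih =>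
    rw [ih, Finset.prod_range_succ, cosPowRatio_succ (a := a + n) (by linarith [n.cast_nonneg (α := ℝ)])]
    push_cast
    rw [show a + (n : ℝ) + x = a + x + n by ring, show a + (n : ℝ) - x = a - x + n by ring,
      show a + ((n : ℝ) + 1) = a + n + 1 by ring]
    ring

lemma cosPowRatio_eq_gamma {a : ℝ} (ha : 1 ≤ a) (x : ℝ) :
    cosPowRatio a x = Gamma a ^ 2 * (Gamma (a + x) * Gamma (a - x))⁻¹ := by
  by_cases hp : ∃ j : ℕ, a + x + j = 0 ∨ a - x + j = 0
  · obtain ⟨j, hj⟩ := hp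
    have hz : Gamma (a + x) * Gamma (a - x) = 0 := by
      rcases hj with hj | hj
      · rw [show a + x = -j by linarith, Gamma_neg_nat_eq_zero, zero_mul]
      · rw [show a - x = -j by linarith, Gamma_neg_nat_eq_zero, mul_zero]
    rw [hz, inv_zero, mul_zero, cosPowRatio_eq_prod ha x (j + 1), Finset.prod_range_succ]
    rcases hj with hj | hj <;> simp [hj]
  · push Not at hp
    have hne : ∀ s : ℝ, (∀ j : ℕ, s + j ≠ 0) → Gamma s ≠ 0 := fun s hs =>
      Gamma_ne_zero fun m hm => hs m (by rw [hm]; ring)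
    have h1 := hne _ fun j => (hp j).1
    have h2 := hne _ fun j => (hp j).2
    have hseq : ∀ n : ℕ, 0 < n → cosPowRatio a x * (GammaSeq (a + x) n * GammaSeq (a - x) n) =
        GammaSeq a n ^ 2 * cosPowRatio (a + 1 + n) x := by
      intro n hn
      have hn' : (0 : ℝ) < n := by exact_mod_cast hn
      rw [cosPowRatio_eq_prod ha x (n + 1), Finset.prod_div_distrib, Finset.prod_mul_distrib,
        Finset.prod_mul_distrib]
      unfold GammaSeq
      have z1 : ∏ j ∈ Finset.range (n + 1), (a + x + j) ≠ 0 :=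
        Finset.prod_ne_zero_iff.2 fun j _ => (hp j).1
      have z2 : ∏ j ∈ Finset.range (n + 1), (a - x + j) ≠ 0 :=
        Finset.prod_ne_zero_iff.2 fun j _ => (hp j).2
      have z3 : ∏ j ∈ Finset.range (n + 1), (a + j) ≠ 0 :=
        Finset.prod_ne_zero_iff.2 fun j _ => by positivity
      rw [rpow_add hn', rpow_sub hn']
      have z4 : (n : ℝ) ^ x ≠ 0 := by positivity
      push_cast
      rw [show a + ((n : ℝ) + 1) = a + 1 + n by ring]
      field_simp
    have hl := ((GammaSeq_tendsto_Gamma (a + x)).mul (GammaSeq_tendsto_Gamma (a - x))).const_mul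
      (cosPowRatio a x)
    have hr := ((GammaSeq_tendsto_Gamma a).pow 2).mul (cosPowRatio_tendsto (a + 1) x)
    have heq := tendsto_nhds_unique (hl.congr' ?_) hr
    · rw [← div_eq_mul_inv, eq_div_iff (mul_ne_zero h1 h2), heq, mul_one]
    · filter_upwards [eventually_gt_atTop 0] with n hn using hseq n hn

lemma exists_fourier_eq_inv_gamma {a b : ℝ} (ha : 1 ≤ a) (hb : 0 < b) :
    ∃ w : ℝ → ℂ, Integrable w ∧ (∀ s, b / 2 < |s| → w s = 0) ∧
      ∀ y, 𝓕 w y = (((Gamma (a + b * y) * Gamma (a - b * y))⁻¹ : ℝ) : ℂ) := by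
  set q := 2 * a - 2 with hq
  have hq0 : 0 ≤ q := by linarith
  set c := (Gamma a ^ 2)⁻¹ / (b * cosPowTransform q 0) with hc
  have hcont : Continuous fun s : ℝ => ((c * cos (π * (s / b)) ^ q : ℝ) : ℂ) :=
    Complex.continuous_ofReal.comp
      (((continuous_cos_pi_mul_rpow hq0).comp (continuous_id.div_const b)).const_mul c)
  refine ⟨Set.indicator (Set.Ioc (-(b / 2)) (b / 2)) fun s => ((c * cos (π * (s / b)) ^ q : ℝ) : ℂ),
    ?_, ?_, ?_⟩
  · rw [integrable_indicator_iff measurableSet_Ioc]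
    exact (hcont.integrableOn_Icc).mono_set Set.Ioc_subset_Icc_self
  · intro s hs
    rw [Set.indicator_of_notMem]
    intro h
    exact absurd (abs_le.2 ⟨h.1.le, h.2⟩) (not_le.2 hs)
  · intro y
    have hΓ : Gamma a ≠ 0 := (Gamma_pos_of_pos (by linarith)).ne'
    have hR : (Gamma (a + b * y) * Gamma (a - b * y))⁻¹ =
        (Gamma a ^ 2)⁻¹ * cosPowRatio a (b * y) := by
      rw [cosPowRatio_eq_gamma ha]
      field_simp
    have hI0 := (cosPowTransform_zero_pos hq0).ne'
    rw [Real.fourier_eq']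
    have h1 : ∀ s : ℝ, Complex.exp (↑(-2 * π * inner ℝ s y) * Complex.I) •
        Set.indicator (Set.Ioc (-(b / 2)) (b / 2)) (fun s => ((c * cos (π * (s / b)) ^ q : ℝ) : ℂ)) s =
        Set.indicator (Set.Ioc (-(b / 2)) (b / 2)) (fun s =>
          (fun t : ℝ => Complex.exp (↑(-2 * π * t * (b * y)) * Complex.I) *
            ((c * cos (π * t) ^ q : ℝ) : ℂ)) (s / b)) s := by
      intro s
      by_cases hs : s ∈ Set.Ioc (-(b / 2)) (b / 2)
      · rw [Set.indicator_of_mem hs, Set.indicator_of_mem hs]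
        simp only [smul_eq_mul, RCLike.inner_apply, conj_trivial]
        congr 4
        field_simp
      · rw [Set.indicator_of_notMem hs, Set.indicator_of_notMem hs, smul_zero]
    simp_rw [h1]
    rw [integral_indicator measurableSet_Ioc, ← intervalIntegral.integral_of_le (by linarith),
      intervalIntegral.integral_comp_div (fun t : ℝ =>
        Complex.exp (↑(-2 * π * t * (b * y)) * Complex.I) * ((c * cos (π * t) ^ q : ℝ) : ℂ)) hb.ne']
    have e1 : b / 2 / b = 1 / 2 := by field_simp
    rw [neg_div, e1]
    set f : ℝ → ℝ := fun t => c * (cos (π * t) ^ q * cos (2 * π * t * (b * y))) with hf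
    set g : ℝ → ℝ := fun t => -(c * (cos (π * t) ^ q * sin (2 * π * t * (b * y)))) with hg
    have hfc : Continuous f := ((continuous_cos_pi_mul_rpow hq0).mul (by fun_prop)).const_mul c
    have hgc : Continuous g := (((continuous_cos_pi_mul_rpow hq0).mul (by fun_prop)).const_mul c).neg
    have h2 : ∀ t : ℝ, Complex.exp (↑(-2 * π * t * (b * y)) * Complex.I) *
        ((c * cos (π * t) ^ q : ℝ) : ℂ) = (f t : ℂ) + (g t : ℂ) * Complex.I := by
      intro t
      rw [Complex.exp_mul_I, ← Complex.ofReal_cos, ← Complex.ofReal_sin,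
        show -2 * π * t * (b * y) = -(2 * π * t * (b * y)) by ring, cos_neg, sin_neg]
      simp only [hf, hg]
      push_cast
      ring
    have hg0 : ∫ t in (-(1 / 2) : ℝ)..(1 / 2), g t = 0 := by
      have hn := intervalIntegral.integral_comp_neg (a := -(1 / 2)) (b := 1 / 2) g
      have hodd : ∀ t, g (-t) = -g t := by
        intro t
        simp only [hg]
        rw [show 2 * π * -t * (b * y) = -(2 * π * t * (b * y)) by ring, mul_neg, cos_neg, sin_neg]
        ring
      simp only [hodd, intervalIntegral.integral_neg, neg_neg] at hn
      linarith
    have hf0 : ∫ t in (-(1 / 2) : ℝ)..(1 / 2), f t = c * cosPowTransform q (b * y) := by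
      simp only [hf, intervalIntegral.integral_const_mul]
      rfl
    simp_rw [h2]
    have hfi : IntervalIntegrable (fun t => (f t : ℂ)) volume (-(1 / 2)) (1 / 2) :=
      (Complex.continuous_ofReal.comp hfc).intervalIntegrable _ _
    have hgi : IntervalIntegrable (fun t => (g t : ℂ) * Complex.I) volume (-(1 / 2)) (1 / 2) :=
      ((Complex.continuous_ofReal.comp hgc).mul continuous_const).intervalIntegrable _ _
    rw [intervalIntegral.integral_add hfi hgi,
      intervalIntegral.integral_mul_const, intervalIntegral.integral_ofReal,
      intervalIntegral.integral_ofReal, hg0, hf0, hR, Complex.real_smul]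
    simp only [Complex.ofReal_zero, zero_mul, add_zero]
    rw [← Complex.ofReal_mul]
    congr 1
    unfold cosPowRatio
    rw [hc, ← hq]
    field_simp

lemma contDiff_inv_Gamma : ContDiff ℝ ∞ fun x : ℝ => (Gamma x)⁻¹ := by
  have h1 : ContDiff ℝ ∞ fun s : ℂ => (Complex.Gamma s)⁻¹ :=
    (Complex.differentiable_one_div_Gamma.contDiff (n := ∞)).restrict_scalars ℝ
  have h2 : (fun x : ℝ => (Gamma x)⁻¹) =
      fun x : ℝ => Complex.reCLM ((Complex.Gamma (Complex.ofRealCLM x))⁻¹) := by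
    ext x
    simp [Complex.Gamma_ofReal, ← Complex.ofReal_inv]
  rw [h2]
  exact Complex.reCLM.contDiff.comp (h1.comp Complex.ofRealCLM.contDiff)

lemma contDiff_inv_Gamma_mul_Gamma (a b : ℝ) :
    ContDiff ℝ ∞ fun x : ℝ => (Gamma (a + b * x) * Gamma (a - b * x))⁻¹ := by
  simp_rw [mul_inv]
  exact (contDiff_inv_Gamma.comp (by fun_prop : ContDiff ℝ ∞ fun x : ℝ => a + b * x)).mul
    (contDiff_inv_Gamma.comp (by fun_prop : ContDiff ℝ ∞ fun x : ℝ => a - b * x))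

lemma rpow_le_of_mul_le_of_le_mul {m M T z : ℝ} (hm : 0 < m) (hT : 0 < T) (h1 : m * T ≤ z)
    (h2 : z ≤ M * T) (p : ℝ) : z ^ p ≤ (m ^ p + M ^ p) * T ^ p := by
  have hmT : 0 < m * T := mul_pos hm hT
  have hM : 0 < M := pos_of_mul_pos_left (hmT.trans_le (h1.trans h2)) hT.le
  have e1 := rpow_pos_of_pos hm p
  have e2 := rpow_pos_of_pos hM p
  have e3 := rpow_pos_of_pos hT p
  rw [add_mul, ← mul_rpow hm.le hT.le, ← mul_rpow hM.le hT.le]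
  rcases le_total 0 p with hp | hp
  · have := rpow_le_rpow (hmT.trans_le h1).le h2 hp
    have := rpow_nonneg hmT.le p
    linarith
  · have := rpow_le_rpow_of_nonpos hmT h1 hp
    have := rpow_nonneg (mul_pos hM hT).le p
    linarith

lemma Gamma_add_le {z s : ℝ} (hz : 0 < z) (hs0 : 0 ≤ s) (hs1 : s ≤ 1) :
    Gamma (z + s) ≤ Gamma z * z ^ s := by
  rcases hs0.eq_or_lt with rfl | hs0
  · simp
  rcases hs1.eq_or_lt with rfl | hs1
  · rw [Gamma_add_one hz.ne', rpow_one, mul_comm]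
  have h := Gamma_mul_add_mul_le_rpow_Gamma_mul_rpow_Gamma hz (show 0 < z + 1 by linarith)
    (show 0 < 1 - s by linarith) hs0 (by ring)
  rw [Gamma_add_one hz.ne', show (1 - s) * z + s * (z + 1) = z + s by ring] at h
  have hG := Gamma_pos_of_pos hz
  rw [mul_rpow hz.le hG.le] at h
  refine h.trans (le_of_eq ?_)
  rw [mul_left_comm, ← rpow_add hG, mul_comm]
  simp

lemma exists_Gamma_le_mul_Gamma_add {u : ℝ} (hu : -1 < u) :
    ∃ C, 0 ≤ C ∧ ∀ z, 2 ≤ z → Gamma z ≤ C * z ^ (-u) * Gamma (z + u) := by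
  have base : ∀ u : ℝ, -1 < u → u ≤ 0 → ∀ z, 2 ≤ z → Gamma z ≤ z ^ (-u) * Gamma (z + u) := by
    intro u hu hu0 z hz
    have h := Gamma_add_le (z := z + u) (s := -u) (by linarith) (by linarith) (by linarith)
    rw [add_neg_cancel_right] at h
    refine h.trans ?_
    rw [mul_comm]
    have := Gamma_pos_of_pos (show 0 < z + u by linarith)
    gcongr <;> linarith
  have step : ∀ n : ℕ, ∀ u : ℝ, -1 < u → u ≤ n → ∀ z, 2 ≤ z →
      Gamma z ≤ 2 ^ n * z ^ (-u) * Gamma (z + u) := by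
    intro n
    induction n with
    | zero => intro u hu hu0 z hz; simpa using base u hu (by simpa using hu0) z hz
    | succ n ih =>
      intro u hu hun z hz
      have hzp : 0 < z := by linarith
      rcases le_or_gt u 0 with h0 | h0
      · refine (base u hu h0 z hz).trans ?_
        have := Gamma_pos_of_pos (show 0 < z + u by linarith)
        rw [mul_assoc]
        exact le_mul_of_one_le_left (by positivity) (one_le_pow₀ (by norm_num))
      · have h := ih (u - 1) (by linarith) (by push_cast at hun; linarith) z hz
        refine h.trans ?_
        have hg := Gamma_add_one (s := z + (u - 1)) (by linarith)
        rw [show z + (u - 1) + 1 = z + u by ring] at hg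
        have hG := Gamma_pos_of_pos (show 0 < z + (u - 1) by linarith)
        rw [hg, show -(u - 1) = -u + 1 by ring, rpow_add_one hzp.ne']
        have hk : z ≤ 2 * (z + (u - 1)) := by linarith
        have hP : 0 ≤ 2 ^ n * z ^ (-u) * Gamma (z + (u - 1)) := by positivity
        calc 2 ^ n * (z ^ (-u) * z) * Gamma (z + (u - 1))
            = 2 ^ n * z ^ (-u) * Gamma (z + (u - 1)) * z := by ring
          _ ≤ 2 ^ n * z ^ (-u) * Gamma (z + (u - 1)) * (2 * (z + (u - 1))) := by gcongr
          _ = _ := by rw [pow_succ]; ring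
  obtain ⟨n, hn⟩ := exists_nat_ge u
  exact ⟨2 ^ n, by positivity, step n u hu hn⟩

lemma inv_Gamma_le_of_reflection {s : ℝ} (hs : s < 1) : |(Gamma s)⁻¹| ≤ Gamma (1 - s) / π := by
  have hG := Gamma_pos_of_pos (show 0 < 1 - s by linarith)
  have h := Gamma_mul_Gamma_one_sub s
  by_cases h0 : Gamma s = 0
  · rw [h0]; simp; positivity
  have hsin : sin (π * s) ≠ 0 := by
    intro h1
    rw [h1, div_zero] at h
    exact (mul_ne_zero h0 hG.ne') h
  have h2 : (Gamma s)⁻¹ = Gamma (1 - s) / π * sin (π * s) := by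
    have := pi_ne_zero
    generalize sin (π * s) = S at *
    field_simp at h ⊢
    linarith
  rw [h2, abs_mul, abs_of_pos (by positivity)]
  exact mul_le_of_le_one_right (by positivity) (abs_sin_le_one _)

lemma exists_inv_Gamma_mul_Gamma_le {a : ℝ} (ha : 0 < a) :
    ∃ C, 0 ≤ C ∧ ∀ x, 0 ≤ x → |(Gamma (a + x) * Gamma (a - x))⁻¹| ≤ C * (1 + x) ^ (1 - 2 * a) := by
  obtain ⟨C, hC, hCz⟩ := exists_Gamma_le_mul_Gamma_add (u := 2 * a - 1) (by linarith)
  have hcont : ContinuousOn (fun x : ℝ => (Gamma (a + x) * Gamma (a - x))⁻¹ * (1 + x) ^ (2 * a - 1))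
      (Set.Icc 0 (1 + a)) := by
    refine ContinuousOn.mul ?_ ?_
    · simpa using (contDiff_inv_Gamma_mul_Gamma a 1).continuous.continuousOn
    · refine ContinuousOn.rpow_const (by fun_prop) fun x hx => Or.inl ?_
      have := hx.1
      positivity
  obtain ⟨C', hC'⟩ := isCompact_Icc.exists_bound_of_continuousOn hcont
  have hK : 0 ≤ C / π * ((1 / (1 + a)) ^ (-(2 * a - 1)) + 1 ^ (-(2 * a - 1))) := by positivity
  refine ⟨|C'| + C / π * ((1 / (1 + a)) ^ (-(2 * a - 1)) + 1 ^ (-(2 * a - 1))), by positivity, ?_⟩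
  intro x hx
  have hT : 0 < 1 + x := by linarith
  have hTp : 0 < (1 + x) ^ (1 - 2 * a) := by positivity
  rw [add_mul]
  rcases le_total x (1 + a) with h | h
  · have h1 := hC' x ⟨hx, h⟩
    rw [norm_mul, norm_eq_abs, norm_eq_abs, abs_of_pos (by positivity : 0 < (1 + x) ^ (2 * a - 1))] at h1
    have h2 : (1 + x) ^ (2 * a - 1) * (1 + x) ^ (1 - 2 * a) = 1 := by
      rw [← rpow_add hT]; simp
    have h3 := mul_le_mul_of_nonneg_right (h1.trans (le_abs_self _)) hTp.le
    rw [mul_assoc, h2, mul_one] at h3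
    have := mul_nonneg hK hTp.le
    linarith
  · have h1 := hCz (x + 1 - a) (by linarith)
    have h2 := inv_Gamma_le_of_reflection (s := a - x) (by linarith)
    rw [show x + 1 - a + (2 * a - 1) = a + x by ring] at h1
    rw [show 1 - (a - x) = x + 1 - a by ring] at h2
    have hG := Gamma_pos_of_pos (show 0 < a + x by linarith)
    have h3 := rpow_le_of_mul_le_of_le_mul (m := 1 / (1 + a)) (M := 1) (T := 1 + x) (z := x + 1 - a)
      (by positivity) hT (by
        rw [div_mul_eq_mul_div, one_mul, div_le_iff₀ (by linarith)]
        nlinarith) (by linarith) (-(2 * a - 1))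
    rw [mul_inv, abs_mul, abs_of_pos (inv_pos.2 hG)]
    have h4 : (Gamma (a + x))⁻¹ * |(Gamma (a - x))⁻¹| ≤ C / π * (x + 1 - a) ^ (-(2 * a - 1)) := by
      rw [inv_mul_le_iff₀ hG]
      refine h2.trans ?_
      rw [div_le_iff₀ pi_pos]
      refine h1.trans (le_of_eq ?_)
      have := pi_ne_zero
      field_simp
    refine h4.trans ?_
    have h5 := mul_le_mul_of_nonneg_left h3 (show 0 ≤ C / π by positivity)
    rw [← mul_assoc, show (-(2 * a - 1)) = 1 - 2 * a by ring] at h5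
    rw [show (-(2 * a - 1)) = 1 - 2 * a by ring]
    have : 0 ≤ |C'| * (1 + x) ^ (1 - 2 * a) := by positivity
    linarith

/-- Decay of the Gamma factor, uniformly for scales `d` in a compact subset of `(0, ∞)`. -/
lemma exists_inv_Gamma_mul_Gamma_scaled_le {a d₁ d₂ : ℝ} (ha : 0 < a) (hd : 0 < d₁) :
    ∃ C, 0 ≤ C ∧ ∀ d, d₁ ≤ d → d ≤ d₂ → ∀ y, 0 ≤ y →
      |(Gamma (a + d * y) * Gamma (a - d * y))⁻¹| ≤ C * (1 + y) ^ (1 - 2 * a) := by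
  obtain ⟨C, hC, h⟩ := exists_inv_Gamma_mul_Gamma_le ha
  refine ⟨C * ((min 1 d₁) ^ (1 - 2 * a) + (max 1 d₂) ^ (1 - 2 * a)), ?_, ?_⟩
  · have : 0 < min 1 d₁ := lt_min one_pos hd
    have : 0 < max 1 d₂ := lt_max_of_lt_left one_pos
    positivity
  intro d h1 h2 y hy
  refine (h (d * y) (mul_nonneg (hd.le.trans h1) hy)).trans ?_
  rw [mul_assoc]
  refine mul_le_mul_of_nonneg_left ?_ hC
  have m1 : min 1 d₁ * 1 ≤ 1 := by simp
  have m2 : min 1 d₁ * y ≤ d * y := mul_le_mul_of_nonneg_right ((min_le_right _ _).trans h1) hy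
  have m3 : d * y ≤ max 1 d₂ * y := mul_le_mul_of_nonneg_right (h2.trans (le_max_right _ _)) hy
  have m4 : (1 : ℝ) ≤ max 1 d₂ := le_max_left _ _
  exact rpow_le_of_mul_le_of_le_mul (lt_min one_pos hd) (by linarith) (by linarith) (by linarith) _

lemma iteratedDeriv_two_mul_zero {𝕜 : Type*} [NormedField 𝕜] [NormedAlgebra ℝ 𝕜] {F K : ℝ → 𝕜}
    (hF : ContDiff ℝ ∞ F) (hK : ContDiff ℝ ∞ K) (hF0 : deriv F 0 = 0) :
    iteratedDeriv 2 (fun y => F y * K y) 0 =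
      iteratedDeriv 2 F 0 * K 0 + F 0 * iteratedDeriv 2 K 0 := by
  have hd : ∀ {f : ℝ → 𝕜}, ContDiff ℝ ∞ f → ∀ y, HasDerivAt f (deriv f y) y := fun hf y =>
    (hf.differentiable (by simp) y).hasDerivAt
  have hd' : ∀ {f : ℝ → 𝕜}, ContDiff ℝ ∞ f → ContDiff ℝ ∞ (deriv f) := fun hf =>
    (contDiff_infty_iff_deriv.1 hf).2
  have h1 : deriv (fun y => F y * K y) = fun y => deriv F y * K y + F y * deriv K y :=
    funext fun y => ((hd hF y).mul (hd hK y)).deriv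
  have h2 : deriv (fun y => deriv F y * K y + F y * deriv K y) 0 = _ :=
    (((hd (hd' hF) 0).mul (hd hK 0)).add ((hd hF 0).mul (hd (hd' hK) 0))).deriv
  simp only [iteratedDeriv_succ, iteratedDeriv_zero, h1, h2, hF0, zero_mul, zero_add, add_zero]

lemma deriv_zero_of_even {E : Type*} [NormedAddCommGroup E] [NormedSpace ℝ E] {F : ℝ → E}
    (hF : ∀ y, F (-y) = F y) : deriv F 0 = 0 := by
  have := deriv_comp_neg F 0
  simp only [hF, neg_zero] at this
  rw [eq_neg_iff_add_eq_zero, ← two_smul ℝ] at this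
  simpa using this

lemma polygamma_one_eq {x : ℝ} (hx : 0 < x) :
    polygamma 1 x = -(deriv (deriv fun s : ℝ => (Gamma s)⁻¹) x * (Gamma x)⁻¹ -
      deriv (fun s : ℝ => (Gamma s)⁻¹) x ^ 2) / ((Gamma x)⁻¹) ^ 2 := by
  have hsm := contDiff_inv_Gamma
  have hd1 : ∀ y, HasDerivAt (fun s : ℝ => (Gamma s)⁻¹) (deriv (fun s : ℝ => (Gamma s)⁻¹) y) y :=
    fun y => (hsm.differentiable (by simp) y).hasDerivAt
  have hd2 : HasDerivAt (deriv fun s : ℝ => (Gamma s)⁻¹) (deriv (deriv fun s : ℝ => (Gamma s)⁻¹) x) x :=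
    ((contDiff_infty_iff_deriv.1 hsm).2.differentiable (by simp) x).hasDerivAt
  have hev : digamma =ᶠ[𝓝 x] fun y => -(deriv (fun s : ℝ => (Gamma s)⁻¹) y / (Gamma y)⁻¹) := by
    filter_upwards [lt_mem_nhds hx] with y hy
    have hG := (Gamma_pos_of_pos hy).ne'
    have h := ((hd1 y).inv (inv_ne_zero hG)).deriv
    have e : (fun s : ℝ => (Gamma s)⁻¹)⁻¹ = Gamma := by ext s; simp
    rw [e] at h
    unfold digamma
    rw [h]
    field_simp
  have hG := (Gamma_pos_of_pos hx).ne'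
  unfold polygamma
  rw [iteratedDeriv_one, hev.deriv_eq]
  have h3 : deriv (fun y => -(deriv (fun s : ℝ => (Gamma s)⁻¹) y / (Gamma y)⁻¹)) x = _ :=
    (hd2.div (hd1 x) (inv_ne_zero hG)).neg.deriv
  rw [h3]
  ring

lemma iteratedDeriv_two_inv_Gamma_mul_Gamma {a : ℝ} (ha : 0 < a) (b : ℝ) :
    iteratedDeriv 2 (fun x : ℝ => (Gamma (a + b * x) * Gamma (a - b * x))⁻¹) 0 =
      -2 * (Gamma a ^ 2)⁻¹ * (b ^ 2 * polygamma 1 a) := by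
  have hsm := contDiff_inv_Gamma
  set h : ℝ → ℝ := fun s : ℝ => (Gamma s)⁻¹ with hh
  have hd1 : ∀ y, HasDerivAt h (deriv h y) y :=
    fun y => (hsm.differentiable (by simp) y).hasDerivAt
  have hd2 : ∀ y, HasDerivAt (deriv h) (deriv (deriv h) y) y := fun y =>
    ((contDiff_infty_iff_deriv.1 hsm).2.differentiable (by simp) y).hasDerivAt
  have e : (fun x : ℝ => (Gamma (a + b * x) * Gamma (a - b * x))⁻¹) =
      fun x => h (a + b * x) * h (a - b * x) := by
    ext x; simp [hh, mul_comm]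
  have hp : ∀ x : ℝ, HasDerivAt (fun x : ℝ => a + b * x) b x := fun x => by
    simpa using ((hasDerivAt_id x).const_mul b).const_add a
  have hm : ∀ x : ℝ, HasDerivAt (fun x : ℝ => a - b * x) (-b) x := fun x => by
    simpa using ((hasDerivAt_id x).const_mul b).const_sub a
  have h1 : deriv (fun x => h (a + b * x) * h (a - b * x)) =
      fun x => deriv h (a + b * x) * b * h (a - b * x) + h (a + b * x) * (deriv h (a - b * x) * -b) :=
    funext fun x => (((hd1 _).comp x (hp x)).mul ((hd1 _).comp x (hm x))).deriv
  have h2 : deriv (fun x => deriv h (a + b * x) * b * h (a - b * x) +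
      h (a + b * x) * (deriv h (a - b * x) * -b)) 0 = _ :=
    (((((hd2 _).comp 0 (hp 0)).mul_const b).mul ((hd1 _).comp 0 (hm 0))).add
      (((hd1 _).comp 0 (hp 0)).mul (((hd2 _).comp 0 (hm 0)).mul_const (-b)))).deriv
  have hG := (Gamma_pos_of_pos ha).ne'
  rw [e]
  simp only [iteratedDeriv_succ, iteratedDeriv_zero, h1, h2, Function.comp_apply, mul_zero, add_zero,
    sub_zero]
  rw [polygamma_one_eq ha, ← hh, ← inv_pow, show (Gamma a)⁻¹ = h a from rfl]
  have : h a ≠ 0 := inv_ne_zero hG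
  field_simp
  ring

lemma contDiff_gammaProd (M : ℕ) (α β : ℕ → ℝ) : ContDiff ℝ ∞ (gammaProd M α β) :=
  contDiff_prod fun k _ => contDiff_inv_Gamma_mul_Gamma (α k) (β k)

lemma gammaProd_neg (M : ℕ) (α β : ℕ → ℝ) (x : ℝ) : gammaProd M α β (-x) = gammaProd M α β x :=
  Finset.prod_congr rfl fun k _ => by
    rw [mul_neg, sub_neg_eq_add, ← sub_eq_add_neg, mul_comm]

lemma gammaProd_zero (M : ℕ) (α β : ℕ → ℝ) :
    gammaProd M α β 0 = (∏ k ∈ Finset.range M, Gamma (α k) ^ 2)⁻¹ := by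
  rw [← Finset.prod_inv_distrib]
  simp [gammaProd, pow_two]

lemma iteratedDeriv_two_gammaProd (M : ℕ) (α β : ℕ → ℝ) (hα : ∀ k ∈ Finset.range M, 0 < α k) :
    iteratedDeriv 2 (gammaProd M α β) 0 =
      -2 * gammaProd M α β 0 * ∑ k ∈ Finset.range M, β k ^ 2 * polygamma 1 (α k) := by
  induction M with
  | zero =>
    have : gammaProd 0 α β = fun _ => 1 := by ext; simp [gammaProd]
    rw [this, iteratedDeriv_const]
    simp
  | succ M ih =>
    have e : gammaProd (M + 1) α β = fun x => gammaProd M α β x *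
        (Gamma (α M + β M * x) * Gamma (α M - β M * x))⁻¹ := by
      ext x; simp only [gammaProd, Finset.prod_range_succ]
    rw [e, iteratedDeriv_two_mul_zero (contDiff_gammaProd M α β)
      (contDiff_inv_Gamma_mul_Gamma _ _) (deriv_zero_of_even (gammaProd_neg M α β)),
      ih (fun k hk => hα k (Finset.mem_range.2 ((Finset.mem_range.1 hk).trans M.lt_succ_self))),
      iteratedDeriv_two_inv_Gamma_mul_Gamma (hα M (Finset.self_mem_range_succ M)),
      Finset.sum_range_succ]
    simp only [mul_zero, add_zero, sub_zero]
    ring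

lemma iteratedDeriv_two_ofReal {f : ℝ → ℝ} (hf : ContDiff ℝ ∞ f) (x : ℝ) :
    iteratedDeriv 2 (fun y => (f y : ℂ)) x = (iteratedDeriv 2 f x : ℝ) := by
  have h : ∀ {f : ℝ → ℝ}, ContDiff ℝ ∞ f → deriv (fun y => (f y : ℂ)) = fun y => ((deriv f y : ℝ) : ℂ) :=
    fun hf => funext fun y => ((hf.differentiable (by simp) y).hasDerivAt.ofReal_comp).deriv
  simp only [iteratedDeriv_succ, iteratedDeriv_zero]
  rw [h hf, h (contDiff_infty_iff_deriv.1 hf).2]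

lemma inv_Gamma_eq_mul_inv_Gamma_add_one (s : ℝ) : (Gamma s)⁻¹ = s * (Gamma (s + 1))⁻¹ := by
  rcases eq_or_ne s 0 with rfl | hs
  · simp
  · rw [Gamma_add_one hs]
    field_simp

namespace IsBandLimited
variable {r : ℝ} {H : ℝ → ℂ}

lemma comp_mul_left {δ : ℝ} (hδ : 0 < δ) (hH : IsBandLimited r H) :
    IsBandLimited (δ * r) fun y => H (δ * y) := by
  obtain ⟨σ, hσ, h0, rfl⟩ := hH
  refine ⟨fun s => (δ⁻¹ : ℂ) * σ (s / δ), ?_, ?_, ?_⟩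
  · exact contDiff_const.mul (hσ.comp (contDiff_id.div_const δ))
  · intro s hs
    simp only []
    rw [h0, mul_zero]
    rw [abs_div, abs_of_pos hδ, lt_div_iff₀ hδ]
    linarith
  · rw [fourier_const_mul_fun]
    ext y
    simp only [Real.fourier_real_eq]
    have h := Measure.integral_comp_div (fun v : ℝ => Real.fourierChar (-(v * (δ * y))) • σ v) δ
    rw [abs_of_pos hδ, Complex.real_smul] at h
    have hδ' : (δ : ℂ) ≠ 0 := by exact_mod_cast hδ.ne'
    rw [eq_inv_mul_iff_mul_eq₀ hδ', ← h]
    congr 1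
    ext s
    congr 3
    field_simp

lemma exists_norm_le (hH : IsBandLimited r H) : ∃ C, 0 ≤ C ∧ ∀ y, ‖H y‖ ≤ C := by
  obtain ⟨f, rfl⟩ := hH.exists_schwartz
  exact ⟨_, norm_nonneg _, f.toBoundedContinuousFunction.norm_coe_le_norm⟩

lemma inv_Gamma_mul {a d : ℝ} (ha : 0 < a) (hd : 0 < d) (hH : IsBandLimited r H) :
    IsBandLimited (d / 2 + r) fun y =>
      (((Gamma (a + d * y) * Gamma (a - d * y))⁻¹ : ℝ) : ℂ) * H y := by
  obtain ⟨w, hw, hw0, hF⟩ := exists_fourier_eq_inv_gamma (a := a + 1) (by linarith) hd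
  have h1 := fourier_mul hw hw0 hH
  have h2 := (h1.const_mul ((a : ℂ) ^ 2)).add (h1.id_mul.id_mul.const_mul (-(d : ℂ) ^ 2))
  convert h2 using 2 with y
  rw [hF y, mul_inv, inv_Gamma_eq_mul_inv_Gamma_add_one, inv_Gamma_eq_mul_inv_Gamma_add_one (a - d * y),
    mul_inv, show a + d * y + 1 = a + 1 + d * y by ring, show a - d * y + 1 = a + 1 - d * y by ring]
  push_cast
  ring

lemma gammaProd_mul {α d : ℕ → ℝ} (M : ℕ) (hα : ∀ k ∈ Finset.range M, 0 < α k)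
    (hd : ∀ k ∈ Finset.range M, 0 < d k) (hH : IsBandLimited r H) :
    IsBandLimited ((∑ k ∈ Finset.range M, d k) / 2 + r) fun y => (gammaProd M α d y : ℂ) * H y := by
  induction M with
  | zero => simpa [gammaProd] using hH
  | succ M ih =>
    have hmem : ∀ k ∈ Finset.range M, k ∈ Finset.range (M + 1) := fun k hk =>
      Finset.mem_range.2 ((Finset.mem_range.1 hk).trans M.lt_succ_self)
    have hlast := Finset.self_mem_range_succ M
    have h := (ih (fun k hk => hα k (hmem k hk)) (fun k hk => hd k (hmem k hk))).inv_Gamma_mul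
      (hα M hlast) (hd M hlast)
    convert h using 1
    · rw [Finset.sum_range_succ]; ring
    · ext y
      simp only [gammaProd, Finset.prod_range_succ]
      push_cast
      ring

end IsBandLimited

lemma exists_isBandLimited_bump : ∃ φ : ℝ → ℂ, IsBandLimited (1 / 2) φ ∧ φ 0 = 1 ∧
    ∀ y, φ (-y) = φ y := by
  let f : ContDiffBump (0 : ℝ) := ⟨1 / 4, 1 / 2, by norm_num, by norm_num⟩
  refine ⟨𝓕 fun s => (f.normed volume s : ℂ), ⟨_, ?_, ?_, rfl⟩, ?_, ?_⟩
  · exact Complex.ofRealCLM.contDiff.comp f.contDiff_normed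
  · intro s hs
    have : s ∉ Function.support (f.normed volume) := by
      rw [f.support_normed_eq, Metric.mem_ball, dist_zero_right, norm_eq_abs, not_lt]
      exact hs.le
    simpa using this
  · rw [Real.fourier_real_eq]
    simp only [mul_zero, neg_zero, AddChar.map_zero_eq_one, one_smul]
    rw [integral_complex_ofReal, f.integral_normed, Complex.ofReal_one]
  · intro y
    have h := congrFun (fourier_comp_neg fun s => (f.normed volume s : ℂ)) y
    simp only [ContDiffBump.normed_neg] at h
    exact h.symm

/-- Two-term Hankel formula for the regularised Gamma product. -/
lemma integral_regularised_gammaProd {α d : ℕ → ℝ} (M m : ℕ) (hα : ∀ k ∈ Finset.range M, 0 < α k)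
    (hd : ∀ k ∈ Finset.range M, 0 < d k) {φ : ℝ → ℂ} (hφ : IsBandLimited (1 / 2) φ) (hφ0 : φ 0 = 1)
    (heven : ∀ y, φ (-y) = φ y) {δ : ℝ} (hδ : 0 < δ)
    (hband : (∑ k ∈ Finset.range M, d k) + δ < 2) :
    ∫ y in Set.Ioi (0 : ℝ), (besselJ (2 * m + 3) (2 * π * y) : ℂ) *
        ((y : ℂ) ^ (2 * m) * ((gammaProd M α d y : ℂ) * φ (δ * y))) =
      (2 * m + 1).factorial / (2 * π ^ (2 * m + 1)) * (gammaProd M α d 0 : ℂ) *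
        (1 + (m + 1) / π ^ 2 * (-2 * (∑ k ∈ Finset.range M, d k ^ 2 * polygamma 1 (α k) : ℝ) +
          δ ^ 2 * iteratedDeriv 2 φ 0)) := by
  have hΦ := hφ.comp_mul_left hδ
  have hH := hΦ.gammaProd_mul M hα hd
  rw [hH.integral_pow_mul_besselJ_mul (by linarith) m
    (fun y => by rw [gammaProd_neg, mul_neg, heven])]
  have hg := contDiff_gammaProd M α d
  have hgc : ContDiff ℝ ∞ fun y => (gammaProd M α d y : ℂ) := Complex.ofRealCLM.contDiff.comp hg
  rw [iteratedDeriv_two_mul_zero hgc hΦ.contDiff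
    (deriv_zero_of_even fun y => by rw [gammaProd_neg]), iteratedDeriv_two_ofReal hg,
    iteratedDeriv_two_gammaProd M α d hα]
  have hc : iteratedDeriv 2 (fun y => φ (δ * y)) 0 = δ ^ 2 * iteratedDeriv 2 φ 0 := by
    have h2 : ContDiff ℝ ((2 : ℕ) : ℕ∞) φ := contDiff_infty.1 hφ.contDiff 2
    simpa using congrFun (iteratedDeriv_comp_const_smul h2 δ) 0
  rw [hc, mul_zero, hφ0]
  push_cast
  ring

lemma gammaProd_const_mul (M : ℕ) (α β : ℕ → ℝ) (c x : ℝ) :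
    gammaProd M α (fun k => c * β k) x = gammaProd M α β (c * x) :=
  Finset.prod_congr rfl fun k _ => by
    rw [show c * β k * x = β k * (c * x) by ring]

lemma exists_gammaProd_le (M : ℕ) {α b : ℕ → ℝ} (hα : ∀ k ∈ Finset.range M, 0 < α k)
    (hb : ∀ k ∈ Finset.range M, 0 < b k) :
    ∃ C, 0 ≤ C ∧ ∀ c, 1 / 2 ≤ c → c ≤ 1 → ∀ y, 0 ≤ y →
      |gammaProd M α (fun k => c * b k) y| ≤ C * (1 + y) ^ (M - 2 * ∑ k ∈ Finset.range M, α k) := by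
  induction M with
  | zero => exact ⟨1, by norm_num, fun c _ _ y _ => by simp [gammaProd]⟩
  | succ M ih =>
    have hmem : ∀ k ∈ Finset.range M, k ∈ Finset.range (M + 1) := fun k hk =>
      Finset.mem_range.2 ((Finset.mem_range.1 hk).trans M.lt_succ_self)
    have hlast := Finset.self_mem_range_succ M
    have hbM := hb M hlast
    obtain ⟨C, hC, h⟩ := ih (fun k hk => hα k (hmem k hk)) (fun k hk => hb k (hmem k hk))
    obtain ⟨C', hC', h'⟩ := exists_inv_Gamma_mul_Gamma_scaled_le (d₁ := 1 / 2 * b M) (d₂ := b M)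
      (hα M hlast) (by positivity)
    refine ⟨C * C', by positivity, fun c hc1 hc2 y hy => ?_⟩
    have e : gammaProd (M + 1) α (fun k => c * b k) y = gammaProd M α (fun k => c * b k) y *
        (Gamma (α M + c * b M * y) * Gamma (α M - c * b M * y))⁻¹ := by
      simp only [gammaProd, Finset.prod_range_succ]
    have hexp : ((M + 1 : ℕ) : ℝ) - 2 * ∑ k ∈ Finset.range (M + 1), α k =
        (M - 2 * ∑ k ∈ Finset.range M, α k) + (1 - 2 * α M) := by
      rw [Finset.sum_range_succ]; push_cast; ring
    have hy1 : 0 < 1 + y := by linarith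
    rw [e, abs_mul, hexp, rpow_add hy1]
    calc _ ≤ (C * (1 + y) ^ (M - 2 * ∑ k ∈ Finset.range M, α k)) * (C' * (1 + y) ^ (1 - 2 * α M)) :=
          mul_le_mul (h c hc1 hc2 y hy) (h' (c * b M) (by gcongr) (by nlinarith) y hy)
            (abs_nonneg _) (by positivity)
      _ = _ := by ring

lemma integral_besselJ_mul_gammaProd {α b : ℕ → ℝ} (M m : ℕ) (hα : ∀ k ∈ Finset.range M, 0 < α k)
    (hb : ∀ k ∈ Finset.range M, 0 < b k) (hband : ∑ k ∈ Finset.range M, b k ≤ 2)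
    (hαsum : (m : ℝ) + (1 / 2) * ((M : ℝ) + 1 / 2) < ∑ k ∈ Finset.range M, α k) :
    ∫ y in Set.Ioi (0 : ℝ), besselJ (2 * m + 3) (2 * π * y) * (y ^ (2 * m) * gammaProd M α b y) =
      (2 * m + 1).factorial / (2 * π ^ (2 * m + 1)) * gammaProd M α b 0 *
        (1 + (m + 1) / π ^ 2 * (-2 * ∑ k ∈ Finset.range M, b k ^ 2 * polygamma 1 (α k))) := by
  obtain ⟨φ, hφ, hφ0, heven⟩ := exists_isBandLimited_bump
  obtain ⟨Cφ, hCφ, hφle⟩ := hφ.exists_norm_le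
  obtain ⟨CJ, hCJ, hJle⟩ := besselJ_decay (2 * m + 3)
  obtain ⟨Cg, hCg, hgle⟩ := exists_gammaProd_le M hα hb
  set δ : ℕ → ℝ := fun n => 1 / ((n : ℝ) + 2) with hδ
  have hδpos : ∀ n, 0 < δ n := fun n => by simp only [hδ]; positivity
  have hδhalf : ∀ n, δ n ≤ 1 / 2 := fun n => by
    simp only [hδ]
    have : (0 : ℝ) ≤ n := n.cast_nonneg
    gcongr
    linarith
  have hδlim : Tendsto δ atTop (𝓝 0) :=
    Tendsto.const_div_atTop
      (tendsto_atTop_add_const_right _ _ (tendsto_natCast_atTop_atTop (R := ℝ))) 1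
  set F : ℕ → ℝ → ℂ := fun n y => (besselJ (2 * m + 3) (2 * π * y) : ℂ) *
        ((y : ℂ) ^ (2 * m) * ((gammaProd M α (fun k => (1 - δ n) * b k) y : ℂ) * φ (δ n * y))) with hF
  have hval : ∀ n, ∫ y in Set.Ioi (0 : ℝ), F n y =
      (2 * m + 1).factorial / (2 * π ^ (2 * m + 1)) * (gammaProd M α b 0 : ℂ) *
        (1 + (m + 1) / π ^ 2 * (-2 * ((1 - δ n) ^ 2 *
          (∑ k ∈ Finset.range M, b k ^ 2 * polygamma 1 (α k) : ℝ)) +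
          δ n ^ 2 * iteratedDeriv 2 φ 0)) := by
    intro n
    have h1 := hδpos n
    have h2 := hδhalf n
    have h := integral_regularised_gammaProd (d := fun k => (1 - δ n) * b k) M m hα
      (fun k hk => mul_pos (by linarith) (hb k hk)) hφ hφ0 heven h1
      (by rw [← Finset.mul_sum]; nlinarith)
    rw [hF, h]
    have e1 : gammaProd M α (fun k => (1 - δ n) * b k) 0 = gammaProd M α b 0 := by
      rw [gammaProd_const_mul, mul_zero]
    have e2 : ∑ k ∈ Finset.range M, ((1 - δ n) * b k) ^ 2 * polygamma 1 (α k) =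
        (1 - δ n) ^ 2 * ∑ k ∈ Finset.range M, b k ^ 2 * polygamma 1 (α k) := by
      rw [Finset.mul_sum]
      exact Finset.sum_congr rfl fun k _ => by ring
    rw [e1, e2]
    push_cast
    ring
  set f : ℝ → ℝ := fun y => besselJ (2 * m + 3) (2 * π * y) * (y ^ (2 * m) * gammaProd M α b y) with hf
  have hlim1 : Tendsto (fun n => ∫ y in Set.Ioi (0 : ℝ), F n y) atTop
      (𝓝 (∫ y in Set.Ioi (0 : ℝ), (f y : ℂ))) := by
    set e : ℝ := 2 * ∑ k ∈ Finset.range M, α k - M - 2 * m + 1 / 2 with he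
    have h_int : Integrable (fun y : ℝ => (CJ * Cg * Cφ) * (1 + ‖y‖) ^ (-e))
        (volume.restrict (Set.Ioi 0)) :=
      ((integrable_one_add_norm (by simp [he]; linarith)).const_mul _).restrict
    refine tendsto_integral_of_dominated_convergence _ (fun n => ?_) h_int (fun n => ?_) ?_
    · have hJc := (continuous_besselJ (2 * m + 3)).comp (continuous_const_mul (2 * π))
      have hgc := (contDiff_gammaProd M α (fun k => (1 - δ n) * b k)).continuous
      exact ((Complex.continuous_ofReal.comp hJc).mul ((Complex.continuous_ofReal.pow _).mul
        ((Complex.continuous_ofReal.comp hgc).mul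
          (hφ.continuous.comp (continuous_const_mul (δ n)))))).aestronglyMeasurable
    · refine ae_restrict_of_forall_mem measurableSet_Ioi fun y hy => ?_
      have hy0 : 0 < y := hy
      have hy1 : 0 < 1 + y := by linarith
      have b1 : |besselJ (2 * m + 3) (2 * π * y)| ≤ CJ * (1 + y) ^ (-(1 / 2) : ℝ) := by
        refine (hJle _ (by positivity)).trans ?_
        refine mul_le_mul_of_nonneg_left ?_ hCJ
        exact rpow_le_rpow_of_nonpos hy1 (by nlinarith [pi_gt_three]) (by norm_num)
      have b2 : y ^ (2 * m) ≤ (1 + y) ^ ((2 * m : ℕ) : ℝ) := by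
        rw [rpow_natCast]
        gcongr
        linarith
      have b3 := hgle (1 - δ n) (by linarith [hδhalf n]) (by linarith [hδpos n]) y hy0.le
      have b4 := hφle (δ n * y)
      simp only [hF, norm_mul, norm_pow, Complex.norm_real, norm_eq_abs, abs_of_pos hy0]
      calc _ ≤ (CJ * (1 + y) ^ (-(1 / 2) : ℝ)) * ((1 + y) ^ ((2 * m : ℕ) : ℝ) *
            ((Cg * (1 + y) ^ (M - 2 * ∑ k ∈ Finset.range M, α k)) * Cφ)) := by
            gcongr
        _ = (CJ * Cg * Cφ) * ((1 + y) ^ (-(1 / 2) : ℝ) * (1 + y) ^ ((2 * m : ℕ) : ℝ) *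
            (1 + y) ^ (M - 2 * ∑ k ∈ Finset.range M, α k)) := by ring
        _ = _ := by
            rw [← rpow_add hy1, ← rpow_add hy1]
            congr 2
            rw [he]
            push_cast
            ring
    · refine ae_of_all _ fun y => ?_
      have hc1 : Tendsto (fun n => (1 - δ n) * y) atTop (𝓝 y) := by
        simpa using (hδlim.const_sub 1).mul_const y
      have hc2 : Tendsto (fun n => δ n * y) atTop (𝓝 0) := by simpa using hδlim.mul_const y
      have t1 := ((contDiff_gammaProd M α b).continuous.tendsto y).comp hc1
      have t2 := (hφ.continuous.tendsto 0).comp hc2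
      have t3 := ((((Complex.continuous_ofReal.tendsto _).comp t1).mul t2).const_mul
        ((y : ℂ) ^ (2 * m))).const_mul (besselJ (2 * m + 3) (2 * π * y) : ℂ)
      simp only [hφ0, mul_one] at t3
      have e : (f y : ℂ) = (besselJ (2 * m + 3) (2 * π * y) : ℂ) *
          ((y : ℂ) ^ (2 * m) * (gammaProd M α b y : ℂ)) := by
        simp only [hf]; push_cast; ring
      rw [e]
      refine t3.congr fun n => ?_
      simp only [hF, Function.comp_apply, gammaProd_const_mul]
  have hδc : Tendsto (fun n => (δ n : ℂ)) atTop (𝓝 0) := by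
    simpa [Function.comp_def] using (Complex.continuous_ofReal.tendsto 0).comp hδlim
  have hlim2 := ((((((hδc.const_sub 1).pow 2).mul_const
    ((∑ k ∈ Finset.range M, b k ^ 2 * polygamma 1 (α k) : ℝ) : ℂ)).const_mul (-2)).add
      ((hδc.pow 2).mul_const (iteratedDeriv 2 φ 0))).const_mul ((m + 1 : ℂ) / π ^ 2)).const_add 1
  have hlim3 := hlim2.const_mul
    ((2 * m + 1).factorial / (2 * π ^ (2 * m + 1)) * (gammaProd M α b 0 : ℂ))
  have hfin := tendsto_nhds_unique hlim1 (hlim3.congr fun n => (hval n).symm)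
  rw [integral_complex_ofReal] at hfin
  apply Complex.ofReal_injective
  rw [hfin]
  push_cast
  simp

theorem hankel_gamma_second_term_odd_order
    (M : ℕ) (hM : 1 ≤ M) (α β : ℕ → ℝ)
    (hα : ∀ k ∈ Finset.range M, 0 < α k) (hβ : ∀ k ∈ Finset.range M, 0 < β k)
    (m : ℕ)
    (hαsum : (m : ℝ) + (1 / 2) * ((M : ℝ) + 1 / 2) < ∑ k ∈ Finset.range M, α k)
    (lam : ℝ) (hlam : π * ∑ k ∈ Finset.range M, β k ≤ lam) :
    ∫ x in Set.Ioi (0 : ℝ), x ^ (2 * m) * besselJ (2 * m + 3) (lam * x) * gammaProd M α β x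
      = ((Nat.factorial (2 * m + 1) : ℝ) / (2 * ∏ k ∈ Finset.range M, (Real.Gamma (α k)) ^ 2))
          * (2 / lam) ^ (2 * m + 1)
          * (1 - (8 * ((m : ℝ) + 1) / lam ^ 2)
                * ∑ k ∈ Finset.range M, (β k) ^ 2 * polygamma 1 (α k)) := by
  have hsum : 0 < ∑ k ∈ Finset.range M, β k :=
    Finset.sum_pos hβ (Finset.nonempty_range_iff.2 (by omega))
  have hl : 0 < lam := (mul_pos pi_pos hsum).trans_le hlam
  set c : ℝ := 2 * π / lam with hc
  have hcpos : 0 < c := by positivity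
  have hlc : lam * c = 2 * π := by rw [hc]; field_simp
  have key := integral_besselJ_mul_gammaProd (b := fun k => c * β k) M m hα
    (fun k hk => mul_pos hcpos (hβ k hk))
    (by rw [← Finset.mul_sum, hc, div_mul_eq_mul_div, div_le_iff₀ hl]; linarith) hαsum
  have hcv := integral_comp_mul_left_Ioi
    (fun x => x ^ (2 * m) * besselJ (2 * m + 3) (lam * x) * gammaProd M α β x) 0 hcpos
  have hcongr : ∀ y : ℝ, (c * y) ^ (2 * m) * besselJ (2 * m + 3) (lam * (c * y)) *
      gammaProd M α β (c * y) = c ^ (2 * m) * (besselJ (2 * m + 3) (2 * π * y) *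
        (y ^ (2 * m) * gammaProd M α (fun k => c * β k) y)) := by
    intro y
    rw [gammaProd_const_mul, ← mul_assoc lam, hlc, mul_pow]
    ring
  simp only [hcongr, mul_zero, smul_eq_mul] at hcv
  rw [integral_const_mul, key, gammaProd_zero, eq_inv_mul_iff_mul_eq₀ hcpos.ne'] at hcv
  rw [← hcv]
  have e2 : ∑ k ∈ Finset.range M, (c * β k) ^ 2 * polygamma 1 (α k) =
      c ^ 2 * ∑ k ∈ Finset.range M, β k ^ 2 * polygamma 1 (α k) := by
    rw [Finset.mul_sum]
    exact Finset.sum_congr rfl fun k _ => by ring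
  rw [e2]
  have hπ := pi_ne_zero
  have e3 : 2 / lam = c / π := by rw [hc]; field_simp
  have e4 : 8 * ((m : ℝ) + 1) / lam ^ 2 = 2 * (m + 1) / π ^ 2 * c ^ 2 := by rw [hc]; field_simp; ring
  rw [e3, e4, div_pow]
  ring
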